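/- Let α be a partition of n and β a one-box-shift of α with β_a = α_a − 1 and β_b = α_b + 1 for a < b, and let θ̂ := Σ_T ((−1)^{|T|} ∏_{u ∈ {R}∖{T}} h_u) θ̂_T : S^α → M^β be defined over ℤ, the sum running over all semistandard α-tableaux T of type β. Then θ̂ ∘ ψ_{i,r} = 0 for all valid pairs (i, r) except possibly (i, r) = (a, β_{a+1} − 1); consequently, by James's kernel-intersection theorem, the image of θ̂ lies in S_ℤ^β if and only if θ̂ ∘ ψ_{a, β_{a+1}−1} = 0. -/

import Mathlib

namespace CarterPayne

open Finset

/-- A partition of `n`, presented by its parts function; rows are indexed from `1`. -/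
structure Partition (n : ℕ) where
  parts : ℕ → ℕ
  parts_zero : parts 0 = 0
  antitone : ∀ ⦃i j : ℕ⦄, 0 < i → i ≤ j → parts j ≤ parts i
  finite_support : (Function.support parts).Finite
  sum_parts : ∑ᶠ i, parts i = n

variable {n : ℕ}

/-- The set of cells `(row, column)` (both 1-indexed) of the Young diagram of `μ`. -/
def Partition.cells (μ : Partition n) : Set (ℕ × ℕ) :=
  {c | 0 < c.1 ∧ 0 < c.2 ∧ c.2 ≤ μ.parts c.1}

/-- A tabloid for the composition `c` of `n`: an assignment of the `n` symbols to rows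
(rows indexed from 1), row `i` receiving exactly `c i` symbols. -/
def Tabloid (n : ℕ) (c : ℕ → ℕ) : Type :=
  {g : Fin n → ℕ // ∀ i, (Finset.univ.filter fun k => g k = i).card = c i}

/-- The permutation module `M^c` over `R`: the free `R`-module on the set of tabloids. -/
abbrev PermMod (R : Type*) [CommRing R] (n : ℕ) (c : ℕ → ℕ) := Tabloid n c →₀ R

/-- The action of a permutation of the symbols on tabloids. -/
def permTabloid (c : ℕ → ℕ) (π : Equiv.Perm (Fin n)) (f : Tabloid n c) : Tabloid n c :=
  ⟨fun k => f.1 (π.symm k), fun i => by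
    rw [← f.2 i]
    exact Finset.card_equiv π.symm fun a => by simp⟩

/-- The `R`-linear action of a permutation of the symbols on `M^c`. -/
noncomputable def permM (R : Type*) [CommRing R] (c : ℕ → ℕ) (π : Equiv.Perm (Fin n)) :
    PermMod R n c →ₗ[R] PermMod R n c :=
  Finsupp.lmapDomain R R (permTabloid c π)

/-- A bijective `μ`-tableau, presented by the placement map which sends each of the
`n` symbols to the cell of the Young diagram containing it. -/
structure Placement (μ : Partition n) where
  pos : Fin n → ℕ × ℕ
  mem : ∀ k, pos k ∈ μ.cells
  inj : Function.Injective pos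
  surj : ∀ c ∈ μ.cells, ∃ k, pos k = c

/-- The column stabilizer of a bijective tableau, as a set of permutations of the symbols. -/
def colStab {μ : Partition n} (T : Placement μ) : Finset (Equiv.Perm (Fin n)) :=
  Finset.univ.filter fun π => ∀ k, (T.pos (π k)).2 = (T.pos k).2

lemma rowFiber_card {μ : Partition n} (T : Placement μ) (i : ℕ) :
    (Finset.univ.filter fun k => (T.pos k).1 = i).card = μ.parts i := by
  classical
  have h : (Finset.univ.filter fun k => (T.pos k).1 = i).card
      = (Finset.Icc 1 (μ.parts i)).card := by
    apply Finset.card_bij (fun k _ => (T.pos k).2)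
    · intro a ha
      simp only [Finset.mem_filter, Finset.mem_univ, true_and] at ha
      obtain ⟨h1, h2, h3⟩ := T.mem a
      exact Finset.mem_Icc.mpr ⟨h2, ha ▸ h3⟩
    · intro a ha b hb hab
      simp only [Finset.mem_filter, Finset.mem_univ, true_and] at ha hb
      exact T.inj (Prod.ext (ha.trans hb.symm) hab)
    · intro j hj
      rw [Finset.mem_Icc] at hj
      have hi0 : 0 < i := by
        rcases Nat.eq_zero_or_pos i with h0 | h0
        · exfalso; rw [h0, μ.parts_zero] at hj; omega
        · exact h0
      obtain ⟨k, hk⟩ := T.surj (i, j) ⟨hi0, hj.1, hj.2⟩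
      exact ⟨k, by simp [hk], by simp [hk]⟩
  rw [h, Nat.card_Icc]
  omega

/-- The row tabloid `{tπ}` associated to the bijective tableau `tπ`. -/
def rowTabloid {μ : Partition n} (T : Placement μ) (π : Equiv.Perm (Fin n)) :
    Tabloid n μ.parts :=
  ⟨fun k => (T.pos (π k)).1, fun i => by
    rw [← rowFiber_card T i]
    exact Finset.card_equiv π fun a => by simp⟩

/-- The polytabloid `e_t` attached to a bijective tableau `t`. -/
noncomputable def polytabloid (R : Type*) [CommRing R] {μ : Partition n} (T : Placement μ) :
    PermMod R n μ.parts :=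
  ∑ π ∈ colStab T, ((Equiv.Perm.sign π : ℤ) : R) • Finsupp.single (rowTabloid T π) (1 : R)

/-- The Specht module `S^μ`, the span in `M^μ` of all polytabloids. -/
noncomputable def Specht (R : Type*) [CommRing R] (μ : Partition n) :
    Submodule R (PermMod R n μ.parts) :=
  Submodule.span R (Set.range fun T : Placement μ => polytabloid R T)

/-- `β` is obtained from the partition `α` of `n` by moving one box from
(the end of) row `a` to (the end of) row `b`; i.e. `β` is a one-box-shift of `α`. -/
structure OneBoxShift {n : ℕ} (α β : Partition n) (a b : ℕ) : Prop where
  a_pos : 0 < a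
  a_lt_b : a < b
  rem : α.parts (a + 1) < α.parts a
  add : α.parts b < α.parts (b - 1)
  at_a : β.parts a = α.parts a - 1
  at_b : β.parts b = α.parts b + 1
  elsewhere : ∀ i, i ≠ a → i ≠ b → β.parts i = α.parts i

-- finiteness of the set of tabloids
lemma tabloid_finite (n : ℕ) (c : ℕ → ℕ) :
    {g : Fin n → ℕ | ∀ i, (Finset.univ.filter fun k => g k = i).card = c i}.Finite := by
  classical
  rcases Set.eq_empty_or_nonempty
      {g : Fin n → ℕ | ∀ i, (Finset.univ.filter fun k => g k = i).card = c i} with h | ⟨g₀, hg₀⟩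
  · rw [h]; exact Set.finite_empty
  · apply Set.Finite.subset (Set.Finite.pi fun _ : Fin n => Set.finite_range g₀)
    intro g hg
    simp only [Set.mem_pi, Set.mem_univ, forall_true_left]
    intro k
    have h1 : (Finset.univ.filter fun k' => g k' = g k).card = c (g k) := hg (g k)
    have h2 : (Finset.univ.filter fun k' => g₀ k' = g k).card = c (g k) := hg₀ (g k)
    have hp : 0 < c (g k) := by
      rw [← h1]
      exact Finset.card_pos.mpr ⟨k, by simp⟩
    rw [← h2] at hp
    obtain ⟨k', hk'⟩ := Finset.card_pos.mp hp
    simp only [Finset.mem_filter] at hk'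
    exact ⟨k', hk'.2⟩

noncomputable instance (c : ℕ → ℕ) : Fintype (Tabloid n c) :=
  (tabloid_finite n c).fintype

lemma cells_finite (μ : Partition n) : μ.cells.Finite := by
  apply Set.Finite.subset (μ.finite_support.prod (Set.finite_Icc 1 (μ.parts 1)))
  rintro ⟨i, j⟩ ⟨h1, h2, h3⟩
  refine Set.mem_prod.mpr ⟨?_, ?_⟩
  · simp only [Function.mem_support]
    intro h0
    rw [h0] at h3; omega
  · exact ⟨h2, le_trans h3 (μ.antitone Nat.one_pos h1)⟩

/-- The finset of cells of the Young diagram of `μ`. -/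
noncomputable def cellFinset (μ : Partition n) : Finset (ℕ × ℕ) := (cells_finite μ).toFinset

/-- An `α`-tableau (a filling of the diagram of `α` by natural numbers) has type `c`
if the entry `j` appears exactly `c j` times. -/
def IsTypeOf (α : Partition n) (c : ℕ → ℕ) (T : ℕ × ℕ → ℕ) : Prop :=
  ∀ j, ((cellFinset α).filter fun cc => T cc = j).card = c j

/-- A filling of the diagram of `α` is semistandard if its entries are nondecreasing
along rows and strictly increasing down columns. -/
def IsSemistandard (α : Partition n) (T : ℕ × ℕ → ℕ) : Prop :=
  (∀ i j j', (i, j) ∈ α.cells → (i, j') ∈ α.cells → j ≤ j' → T (i, j) ≤ T (i, j')) ∧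
  (∀ i i' j, (i, j) ∈ α.cells → (i', j) ∈ α.cells → i < i' → T (i, j) < T (i', j))

/-- Number of entries equal to `j` in row `i` of the `α`-tableau `T`. -/
def rowContent (α : Partition n) (T : ℕ × ℕ → ℕ) (i j : ℕ) : ℕ :=
  ((Finset.Icc 1 (α.parts i)).filter fun col => T (i, col) = j).card

open Classical in
/-- James' homomorphism `θ_T : M^α → M^c` attached to an `α`-tableau `T` of type `c`:
an `α`-tabloid `f` is sent to the sum of all `c`-tabloids `g` such that, for all `i`, `j`,
exactly `rowContent α T i j` symbols lie in row `i` of `f` and row `j` of `g`.  (This is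
the sum over the row-equivalence class of `T` of the corresponding tabloids.) -/
noncomputable def theta (R : Type*) [CommRing R] (α : Partition n) (c : ℕ → ℕ)
    (T : ℕ × ℕ → ℕ) : PermMod R n α.parts →ₗ[R] PermMod R n c :=
  Finsupp.lift (PermMod R n c) R (Tabloid n α.parts) fun f =>
    ∑ g ∈ Finset.univ.filter (fun g : Tabloid n c =>
        ∀ i j, (Finset.univ.filter fun k => f.1 k = i ∧ g.1 k = j).card = rowContent α T i j),
      Finsupp.single g (1 : R)

/-- The restriction `θ̂_T` of `θ_T` to the Specht module `S^α`. -/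
noncomputable def thetaHat (R : Type*) [CommRing R] (α : Partition n) (c : ℕ → ℕ)
    (T : ℕ × ℕ → ℕ) : ↥(Specht R α) →ₗ[R] PermMod R n c :=
  (theta R α c T).comp (Specht R α).subtype

/-- The composition `ν` obtained from `c` by replacing the rows `i`, `i+1` with rows of
sizes `c i + c (i+1) - r` and `r`. -/
def nuComp (c : ℕ → ℕ) (i r : ℕ) : ℕ → ℕ :=
  fun j => if j = i then c i + c (i + 1) - r else if j = i + 1 then r else c j

open Classical in
/-- James' homomorphism `ψ_{i,r} : M^c → M^ν`: a tabloid is sent to the sum of all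
tabloids obtained from it by changing all but `r` of the entries in row `i+1` to `i`. -/
noncomputable def psi (R : Type*) [CommRing R] (c : ℕ → ℕ) (i r : ℕ) :
    PermMod R n c →ₗ[R] PermMod R n (nuComp c i r) :=
  Finsupp.lift (PermMod R n (nuComp c i r)) R (Tabloid n c) fun f =>
    ∑ g ∈ Finset.univ.filter (fun g : Tabloid n (nuComp c i r) =>
        ∀ k, g.1 k = f.1 k ∨ (f.1 k = i + 1 ∧ g.1 k = i)),
      Finsupp.single g (1 : R)

/-- Normalized semistandard `α`-tableaux of type `c` (entries outside the diagram are `0`). -/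
def SSTSet (α : Partition n) (c : ℕ → ℕ) : Set (ℕ × ℕ → ℕ) :=
  {T | IsSemistandard α T ∧ IsTypeOf α c T ∧ ∀ cc, cc ∉ α.cells → T cc = 0}

lemma SSTSet_finite (α : Partition n) (c : ℕ → ℕ) (hc : (Function.support c).Finite) :
    (SSTSet α c).Finite := by
  classical
  have hinj : Set.InjOn (fun T (cc : ↥(cellFinset α)) => T cc.1) (SSTSet α c) := by
    intro T hT S hS h
    funext cc
    by_cases hcc : cc ∈ α.cells
    · have hmem : cc ∈ cellFinset α := (Set.Finite.mem_toFinset _).mpr hcc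
      exact congrFun h ⟨cc, hmem⟩
    · rw [hT.2.2 cc hcc, hS.2.2 cc hcc]
  have himage : ((fun T (cc : ↥(cellFinset α)) => T cc.1) '' SSTSet α c) ⊆
      Set.univ.pi (fun _ : ↥(cellFinset α) => insert 0 (Function.support c)) := by
    rintro _ ⟨T, hT, rfl⟩
    intro cc _
    have h1 := hT.2.1 (T cc.1)
    have h2 : cc.1 ∈ (cellFinset α).filter fun d => T d = T cc.1 :=
      Finset.mem_filter.mpr ⟨cc.2, rfl⟩
    have h3 : 0 < c (T cc.1) := h1 ▸ Finset.card_pos.mpr ⟨cc.1, h2⟩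
    exact Set.mem_insert_iff.mpr (Or.inr (by
      simp only [Function.mem_support]
      omega))
  exact Set.Finite.of_finite_image
    (Set.Finite.subset (Set.Finite.pi fun _ => hc.insert 0) himage) hinj

/-- The finset of all (normalized) semistandard `α`-tableaux of type `β`. -/
noncomputable def sstFinset (α β : Partition n) : Finset (ℕ × ℕ → ℕ) :=
  (SSTSet_finite α β.parts β.finite_support).toFinset

/-- `T̂(u)`, the entry at the end of row `u` of `T`. -/
def hatOf (α : Partition n) (T : ℕ × ℕ → ℕ) (u : ℕ) : ℕ := T (u, α.parts u)

/-- The semistandard `α`-set `{T}` of `T`: those rows `u ∈ {a, …, b-1}` with `T̂(u) ≠ u`. -/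
def Tset (α : Partition n) (a b : ℕ) (T : ℕ × ℕ → ℕ) : Finset ℕ :=
  (Finset.Icc a (b - 1)).filter fun u => hatOf α T u ≠ u

/-- The removable set `{R}`: those rows `i ∈ {a, …, b-1}` such that `(i, α_i)` is a
removable node of `[α]`. -/
def Rset (α : Partition n) (a b : ℕ) : Finset ℕ :=
  (Finset.Icc a (b - 1)).filter fun i => α.parts (i + 1) < α.parts i

/-- The hook lengths `h_i` in the `(α_b + 1)`-th column of `[α]` (with `h_i = 0` for `i ≥ b`):
`h_i = α_i - α_b + b - i - 1`. -/
def hook (α : Partition n) (b i : ℕ) : ℤ :=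
  if i < b then (α.parts i : ℤ) - (α.parts b : ℤ) + (b : ℤ) - (i : ℤ) - 1 else 0

/-- `T̂⁻¹(v)`: the row `u ∈ {a, …, b-1}` with `T̂(u) = v`. -/
noncomputable def invHat (α : Partition n) (a b : ℕ) (T : ℕ × ℕ → ℕ) (v : ℕ) : ℕ :=
  sInf {u | a ≤ u ∧ u ≤ b - 1 ∧ hatOf α T u = v}

/-- The smallest element of `X` greater than `u`, or `b` if there is none. -/
noncomputable def nextIn (X : Finset ℕ) (b u : ℕ) : ℕ := sInf ({v | v ∈ X ∧ u < v} ∪ {b})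

/-- The bijection `T̂ : {a,…,b-1} → {a+1,…,b}` determined by a semistandard set `X`:
`T̂` maps each `u ∈ X` to the next element of `X ∪ {b}` above it, and fixes `u ∉ X`. -/
noncomputable def hatOfSet (X : Finset ℕ) (b u : ℕ) : ℕ :=
  if u ∈ X then nextIn X b u else u

open Classical in
/-- The (normalized) semistandard `α`-tableau of type `β` whose semistandard set is `X`:
every cell of row `i` contains `i`, except that for `a ≤ i ≤ b-1` the last cell of row `i`
contains `T̂(i)` (where `T̂` is the bijection determined by `X`). -/
noncomputable def tableauOfSet (α : Partition n) (a b : ℕ) (X : Finset ℕ) : ℕ × ℕ → ℕ :=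
  fun cc =>
    if cc ∈ α.cells then
      (if a ≤ cc.1 ∧ cc.1 ≤ b - 1 ∧ cc.2 = α.parts cc.1 then hatOfSet X b cc.1 else cc.1)
    else 0

/-- `X` is a semistandard `α`-set of type `β` (for the one-box shift from row `a` to row `b`):
`a ∈ X ⊆ {a, …, b-1}`, and `u ∈ X` together with `α_{u+1} = α_u` forces `u+1 ∈ X`. -/
def IsSSSet (α : Partition n) (a b : ℕ) (X : Finset ℕ) : Prop :=
  a ∈ X ∧ (∀ u ∈ X, a ≤ u ∧ u ≤ b - 1) ∧
    ∀ u ∈ X, α.parts (u + 1) = α.parts u → u + 1 ∈ X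

/-- The coefficient `(-1)^{|T|} ∏_{u ∈ {R}\{T}} h_u` of `θ̂_T` in the Carter-Payne
homomorphism. -/
noncomputable def cpCoeff (α : Partition n) (a b : ℕ) (T : ℕ × ℕ → ℕ) : ℤ :=
  (-1) ^ (Tset α a b T).card * ∏ u ∈ Rset α a b \ Tset α a b T, hook α b u

/-! ### The general linear Lie algebra acting on tensor space -/

/-- Tensor space: integer valued functions on words. -/
abbrev VV (n : ℕ) := (Fin n → ℕ) → ℤ

/-- The matrix unit acting at the tensor place `k`. -/
def e1 (k : Fin n) (u v : ℕ) : Module.End ℤ (VV n) where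
  toFun φ g := if g k = u then φ (Function.update g k v) else 0
  map_add' x y := by
    funext g
    by_cases h : g k = u <;> simp [h]
  map_smul' c x := by
    funext g
    by_cases h : g k = u <;> simp [h]

lemma e1_apply (k : Fin n) (u v : ℕ) (φ : VV n) (g : Fin n → ℕ) :
    e1 k u v φ g = if g k = u then φ (Function.update g k v) else 0 := rfl

/-- The matrix unit `E_{uv}` (changing one letter `v` to `u`). -/
def EE (u v : ℕ) : Module.End ℤ (VV n) := ∑ k, e1 k u v

lemma EE_apply (u v : ℕ) (φ : VV n) (g : Fin n → ℕ) :
    EE u v φ g = ∑ k, if g k = u then φ (Function.update g k v) else 0 := by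
  simp [EE, LinearMap.sum_apply, Finset.sum_apply, e1_apply]

lemma e1_mul_same (k : Fin n) (u v w x : ℕ) :
    e1 k u v * e1 k w x = if v = w then e1 k u x else 0 := by
  apply LinearMap.ext; intro φ; funext g
  rw [Module.End.mul_apply, e1_apply, e1_apply]
  by_cases h : v = w
  · simp [h, e1_apply]
  · simp [h]

lemma e1_mul_ne {k l : Fin n} (hkl : k ≠ l) (u v w x : ℕ) :
    e1 k u v * e1 l w x = e1 l w x * e1 k u v := by
  apply LinearMap.ext; intro φ; funext g
  simp only [Module.End.mul_apply, e1_apply]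
  rw [Function.update_of_ne hkl.symm, Function.update_of_ne hkl, Function.update_comm hkl]
  split_ifs <;> rfl

lemma EE_comm (u v w x : ℕ) :
    (EE u v * EE w x : Module.End ℤ (VV n)) = EE w x * EE u v + (if v = w then EE u x else 0)
      - (if x = u then EE w v else 0) := by
  have h1 : (if v = w then (EE u x : Module.End ℤ (VV n)) else 0)
      = ∑ k, if v = w then e1 k u x else 0 := by
    split_ifs <;> simp [EE]
  have h2 : (if x = u then (EE w v : Module.End ℤ (VV n)) else 0)
      = ∑ k, if x = u then e1 k w v else 0 := by
    split_ifs <;> simp [EE]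
  rw [h1, h2]
  simp only [EE, Finset.sum_mul_sum]
  rw [Finset.sum_comm (f := fun i j => e1 i w x * e1 j u v), ← Finset.sum_add_distrib,
    ← Finset.sum_sub_distrib]
  apply Finset.sum_congr rfl
  intro k _
  have h3 : ∑ l, e1 k u v * e1 l w x - ∑ l, e1 l w x * e1 k u v
      = (if v = w then e1 k u x else 0) - (if x = u then e1 k w v else 0) := by
    rw [← Finset.sum_sub_distrib, Finset.sum_eq_single k]
    · rw [e1_mul_same, e1_mul_same]
    · intro l _ hl
      rw [e1_mul_ne hl.symm, sub_self]
    · simp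
  rw [add_sub_assoc, ← h3]; abel

lemma EE_comm_apply (u v w x : ℕ) (φ : VV n) :
    EE u v (EE w x φ) = EE w x (EE u v φ) + (if v = w then EE u x φ else 0)
      - (if x = u then EE w v φ else 0) := by
  have := congrArg (fun f : Module.End ℤ (VV n) => f φ) (EE_comm u v w x)
  simp only [Module.End.mul_apply, LinearMap.sub_apply, LinearMap.add_apply] at this
  rw [this]
  split_ifs <;> simp

/-! ### The lowering operator -/

/-- Auxiliary recursion. -/
noncomputable def pp (A : ℕ → ℕ → ℤ) (b : ℕ) (e : VV n) : ℕ → ℕ → VV n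
  | 0, _ => 0
  | d + 1, q => EE (b - d) q (if d = 0 then e else -pp A b e d (b - d))
      + A (b - d) q • pp A b e d q

/-- Partial lowering sums. -/
noncomputable def pl (A : ℕ → ℕ → ℤ) (b : ℕ) (e : VV n) (u q : ℕ) : VV n := pp A b e (b + 1 - u) q

/-- The lowered vectors. -/
noncomputable def LL (A : ℕ → ℕ → ℤ) (b : ℕ) (e : VV n) (u : ℕ) : VV n :=
  if u = b then e else - pl A b e (u + 1) u

lemma pl_top (A : ℕ → ℕ → ℤ) (b : ℕ) (e : VV n) (q : ℕ) : pl A b e (b + 1) q = 0 := by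
  simp [pl, pp]

lemma LL_top (A : ℕ → ℕ → ℤ) (b : ℕ) (e : VV n) : LL A b e b = e := by
  simp [LL]

lemma LL_lt (A : ℕ → ℕ → ℤ) {b u : ℕ} (e : VV n) (h : u < b) :
    LL A b e u = - pl A b e (u + 1) u := by
  simp [LL, h.ne]

lemma LL_succ (A : ℕ → ℕ → ℤ) (b : ℕ) (e : VV n) : LL A b e (b + 1) = 0 := by
  simp [LL, pl, pp]

lemma pl_step (A : ℕ → ℕ → ℤ) {b u : ℕ} (e : VV n) (hu : u ≤ b) (q : ℕ) :
    pl A b e u q = EE u q (LL A b e u) + A u q • pl A b e (u + 1) q := by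
  obtain ⟨d, rfl⟩ := Nat.exists_eq_add_of_le hu
  have h1 : u + d + 1 - u = d + 1 := by omega
  have h2 : u + d + 1 - (u + 1) = d := by omega
  have h3 : u + d - d = u := by omega
  simp only [pl, LL, h1, h2, pp, h3]
  by_cases hd : d = 0 <;> simp [hd]

section lowering

variable {b : ℕ} {h : ℕ → ℤ} {e : VV n} {w : ℕ → ℤ}

/-- The commutation facts proved by downward induction. -/
structure Cl (h : ℕ → ℤ) (b : ℕ) (e : VV n) (w : ℕ → ℤ) (u : ℕ) : Prop where
  D1 : ∀ q i, q < u → 1 ≤ i → i ≠ q → i + 1 ≠ u → EE i (i + 1) (pl (fun x _ => h x) b e u q) = 0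
  D2 : ∀ q i, q < i → i + 1 = u → EE i (i + 1) (pl (fun x _ => h x) b e u q)
    = EE i q (LL (fun x _ => h x) b e u)
  D3 : ∀ q, 1 ≤ q → q + 1 < u → EE q (q + 1) (pl (fun x _ => h x) b e u q)
    = - pl (fun x _ => h x) b e u (q + 1)
  D4 : ∀ q, 1 ≤ q → q + 1 = u → u ≤ b → EE q (q + 1) (pl (fun x _ => h x) b e u q)
    = h q • LL (fun x _ => h x) b e u
  W1 : ∀ q x, q < u → x < u → x ≠ q → EE x x (pl (fun x _ => h x) b e u q)
    = w x • pl (fun x _ => h x) b e u q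
  W2 : ∀ q, q < u → EE q q (pl (fun x _ => h x) b e u q)
    = (w q - 1) • pl (fun x _ => h x) b e u q

lemma cl_top : Cl h b e w (b + 1) where
  D1 := by intros; simp [pl_top]
  D2 := by intros; simp [pl_top, LL_succ]
  D3 := by intros; simp [pl_top]
  D4 := by intros; omega
  W1 := by intros; simp [pl_top]
  W2 := by intros; simp [pl_top]

lemma cl_step (u : ℕ) (hub : u ≤ b)
    (hA : ∀ i, 1 ≤ i → i ≠ u → EE i (i + 1) (LL (fun x _ => h x) b e u) = 0)
    (hB : 1 ≤ u → EE u (u + 1) (LL (fun x _ => h x) b e u) = -(h u • LL (fun x _ => h x) b e (u + 1)))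
    (hC : ∀ x, x < u → EE x x (LL (fun x _ => h x) b e u) = w x • LL (fun x _ => h x) b e u)
    (hD : ∀ q, q + 1 = u → w q • LL (fun x _ => h x) b e u - EE u u (LL (fun x _ => h x) b e u)
      - h u • pl (fun x _ => h x) b e (u + 1) u = h q • LL (fun x _ => h x) b e u)
    (ih : Cl h b e w (u + 1)) : Cl h b e w u where
  D1 := by
    intro q i hq hi hiq hiu
    rw [pl_step _ _ hub, map_add, map_smul, EE_comm_apply, if_neg hiu, if_neg hiq.symm]
    by_cases hi2 : i = u
    · subst hi2
      rw [hB hi, ih.D2 q i hq rfl, map_neg, map_smul]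
      simp only [add_zero, sub_zero, neg_add_cancel]
    · rw [hA i hi hi2, ih.D1 q i (by omega) hi hiq (by omega)]
      simp
  D2 := by
    intro q i hq hi
    rw [pl_step _ _ hub, map_add, map_smul, EE_comm_apply, if_pos hi, if_neg (by omega),
      hA i (by omega) (by omega), ih.D1 q i (by omega) (by omega) (by omega) (by omega)]
    simp
  D3 := by
    intro q hq hu
    rw [pl_step _ _ hub, map_add, map_smul, EE_comm_apply, if_neg (by omega), if_pos rfl,
      hA q hq (by omega), ih.D3 q hq (by omega), pl_step _ _ hub]
    simp only [map_zero]
    module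
  D4 := by
    intro q hq hu _
    rw [pl_step _ _ hub, map_add, map_smul, EE_comm_apply, if_pos hu, if_pos rfl,
      hA q hq (by omega), ih.D3 q hq (by omega), hC q (by omega), ← hD q hu, hu]
    simp [sub_eq_add_neg]
  W1 := by
    intro q x hq hx hxq
    rw [pl_step _ _ hub, map_add, map_smul, EE_comm_apply, if_neg (by omega), if_neg (by omega),
      hC x hx, ih.W1 q x (by omega) (by omega) hxq]
    simp only [map_smul]
    module
  W2 := by
    intro q hq
    rw [pl_step _ _ hub, map_add, map_smul, EE_comm_apply, if_neg (by omega), if_pos rfl,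
      hC q hq, ih.W2 q (by omega)]
    simp only [map_smul]
    module

/-- Hypotheses on a highest weight vector `e` of weight `w` and the hook numbers `h`. -/
structure HW (h : ℕ → ℤ) (b : ℕ) (e : VV n) (w : ℕ → ℤ) : Prop where
  hw : ∀ i, 1 ≤ i → EE i (i + 1) e = 0
  wt : ∀ i, EE i i e = w i • e
  hb : h b = 0
  hstep : ∀ q, q + 1 < b → h q = w q - w (q + 1) + 1 + h (q + 1)
  hlast : ∀ q, q + 1 = b → h q = w q - w b

lemma cl_all (H : HW h b e w) (d : ℕ) : ∀ u, u + d = b + 1 → Cl h b e w u := by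
  induction d with
  | zero => intro u hu; rw [show u = b + 1 by omega]; exact cl_top
  | succ d ih =>
    intro u hu
    have hub : u ≤ b := by omega
    have ih' := ih (u + 1) (by omega)
    by_cases hbu : u = b
    · subst hbu
      apply cl_step u le_rfl _ _ _ _ ih'
      · intro i hi _; rw [LL_top]; exact H.hw i hi
      · intro hi; rw [LL_top, H.hw u hi, H.hb]; simp
      · intro x _; rw [LL_top, H.wt]
      · intro q hq; rw [LL_top, pl_top, H.wt, H.hlast q hq, sub_smul]; simp
    · have hlt : u < b := by omega
      apply cl_step u hub _ _ _ _ ih'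
      · intro i hi hiu; rw [LL_lt _ _ hlt, map_neg, ih'.D1 u i (by omega) hi hiu (by omega)]; simp
      · intro hi; rw [LL_lt _ _ hlt, map_neg, ih'.D4 u hi rfl (by omega)]
      · intro x hx; rw [LL_lt _ _ hlt, map_neg, ih'.W1 u x (by omega) (by omega) (by omega)]; simp
      · intro q hq
        have h1 : pl (fun x _ => h x) b e (u + 1) u = - LL (fun x _ => h x) b e u := by
          rw [LL_lt _ _ hlt]; simp
        have h2 : EE u u (LL (fun x _ => h x) b e u) = (w u - 1) • LL (fun x _ => h x) b e u := by
          rw [LL_lt _ _ hlt, map_neg, ih'.W2 u (by omega)]; simp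
        rw [h1, h2, H.hstep q (by omega), hq]
        module

lemma LL_E_zero (H : HW h b e w) {u i : ℕ} (hu : u < b) (hi : 1 ≤ i) (hiu : i ≠ u) :
    EE i (i + 1) (LL (fun x _ => h x) b e u) = 0 := by
  rw [LL_lt _ _ hu, map_neg, (cl_all H (b - u) (u + 1) (by omega)).D1 u i (by omega) hi hiu (by omega)]
  simp

lemma LL_E_self (H : HW h b e w) {u : ℕ} (hu : u < b) (hi : 1 ≤ u) :
    EE u (u + 1) (LL (fun x _ => h x) b e u) = - (h u • LL (fun x _ => h x) b e (u + 1)) := by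
  rw [LL_lt _ _ hu, map_neg, (cl_all H (b - u) (u + 1) (by omega)).D4 u hi rfl (by omega)]

lemma low_zero (q : ℕ) (hq : EE (q + 1) q e = 0) (d : ℕ) :
    ∀ u, u + d = b + 1 → q + 1 < u → ∀ r, r < u → q + 1 < r →
      EE (q + 1) q (pl (fun x _ => h x) b e u r) = 0 := by
  induction d with
  | zero => intro u hu _ _ _ _; rw [show u = b + 1 by omega]; simp [pl_top]
  | succ d ih =>
    intro u hu hqu r hr hqr
    have ih' := ih (u + 1) (by omega) (by omega)
    rw [pl_step _ _ (by omega), map_add, map_smul, EE_comm_apply, if_neg (by omega),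
      if_neg (by omega), ih' r (by omega) hqr]
    have : EE (q + 1) q (LL (fun x _ => h x) b e u) = 0 := by
      rw [LL]
      split_ifs with hh
      · exact hq
      · rw [map_neg, ih' u (by omega) hqu]; simp
    simp [this]

lemma low_swap (q : ℕ) (hq : EE (q + 1) q e = 0) (d : ℕ) :
    ∀ u, u + d = b + 1 → q + 1 < u →
      EE (q + 1) q (pl (fun x _ => h x) b e u (q + 1)) = - pl (fun x _ => h x) b e u q := by
  induction d with
  | zero => intro u hu _; rw [show u = b + 1 by omega]; simp [pl_top]
  | succ d ih =>
    intro u hu hqu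
    rw [pl_step _ _ (by omega), map_add, map_smul, EE_comm_apply, if_neg (by omega),
      if_pos rfl, ih (u + 1) (by omega) (by omega)]
    have : EE (q + 1) q (LL (fun x _ => h x) b e u) = 0 := by
      rw [LL]
      split_ifs with hh
      · exact hq
      · rw [map_neg, low_zero q hq d (u + 1) (by omega) (by omega) u (by omega) hqu]; simp
    rw [this, pl_step _ _ (show u ≤ b by omega) q, map_zero]
    module

lemma pl_nonrem (q : ℕ) (hq : EE (q + 1) q e = 0) (hqb : q + 1 < b) (hh : h q = h (q + 1) + 1) :
    pl (fun x _ => h x) b e (q + 1) q = h q • EE (q + 1) q (LL (fun x _ => h x) b e (q + 1)) := by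
  have h1 := low_swap (b := b) (h := h) q hq (b - q - 1) (q + 2) (by omega) (by omega)
  have h2 : pl (fun x _ => h x) b e (q + 2) q = EE (q + 1) q (LL (fun x _ => h x) b e (q + 1)) := by
    rw [LL_lt _ _ hqb, map_neg, h1]; simp
  rw [pl_step _ _ (by omega), h2, hh, add_smul, one_smul, add_comm]

/-- The coefficients of the semistandard recursion. -/
noncomputable def AS (R : ℕ → Prop) (h : ℕ → ℤ) (u q : ℕ) : ℤ :=
  open Classical in
  if ¬ R q ∧ q + 1 = u then 0 else if R u then h u else 1

open Classical in
lemma pl_eq_ss (H : HW h b e w) (R : ℕ → Prop) (hRb : ∀ q, q + 1 = b → R q)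
    (hR : ∀ q, 1 ≤ q → q + 1 < b → ¬ R q → EE (q + 1) q e = 0 ∧ w q = w (q + 1)) (d : ℕ) :
    ∀ u, u + d = b → ∀ q, 1 ≤ q → q < u → (R q ∨ q + 1 = u) →
      pl (fun x _ => h x) b e u q = ((if R q then 1 else h q) *
        ∏ x ∈ (Finset.Ico u b).filter (fun x => ¬ R x), h x) • pl (AS R h) b e u q := by
  induction d with
  | zero =>
    intro u hu q hq1 hq hR'
    obtain rfl : u = b := by omega
    have hRq : R q := by
      rcases hR' with h1 | h1
      · exact h1
      · exact hRb q h1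
    rw [pl_step _ _ le_rfl, pl_step _ _ le_rfl, LL_top, LL_top, pl_top, pl_top]
    simp [hRq]
  | succ d ih =>
    intro u hu q hq1 hq hR'
    have hIco : Finset.Ico u b = insert u (Finset.Ico (u + 1) b) := by
      ext x; simp only [Finset.mem_Ico, Finset.mem_insert]; omega
    have ih1 := ih (u + 1) (by omega) u (by omega) (by omega) (Or.inr rfl)
    have hL : LL (fun x _ => h x) b e u = ((if R u then 1 else h u) *
        ∏ x ∈ (Finset.Ico (u + 1) b).filter (fun x => ¬ R x), h x) • LL (AS R h) b e u := by
      rw [LL_lt _ _ (by omega), LL_lt _ _ (by omega), ih1]; simp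
    by_cases hRq : R q
    · have ih2 := ih (u + 1) (by omega) q hq1 (by omega) (Or.inl hRq)
      rw [pl_step _ _ (by omega), pl_step (AS R h) _ (by omega), ih2, hL, hIco,
        Finset.filter_insert]
      have hA : AS R h u q = if R u then h u else 1 := by simp [AS, hRq]
      rw [hA]
      by_cases hRu : R u
      · simp only [hRu, hRq, not_true_eq_false, if_true, if_false, map_smul]
        module
      · simp only [hRu, hRq, not_false_eq_true, if_true, if_false, map_smul]
        rw [Finset.prod_insert (by simp)]
        module
    · obtain rfl : q + 1 = u := by tauto
      have hq2 : q + 1 < b := by omega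
      obtain ⟨g1, g2⟩ := hR q hq1 hq2 hRq
      rw [pl_nonrem q g1 hq2 (by rw [H.hstep q hq2, g2]; ring), pl_step (AS R h) _ (by omega), hL,
        hIco, Finset.filter_insert]
      have hA : AS R h (q + 1) q = 0 := by simp [AS, hRq]
      rw [hA]
      by_cases hRu : R (q + 1)
      · simp only [hRu, hRq, not_true_eq_false, if_true, if_false, map_smul]
        module
      · simp only [hRu, hRq, not_false_eq_true, if_true, if_false, map_smul]
        rw [Finset.prod_insert (by simp)]
        module

end lowering

/-! ### Embedding of permutation modules into tensor space -/

/-- Indicator function. -/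
def dl (f : Fin n → ℕ) : VV n := fun g => if g = f then 1 else 0

/-- Make a tabloid. -/
def mkT {c : ℕ → ℕ} (g : Fin n → ℕ) (hg : ∀ i, (Finset.univ.filter fun k => g k = i).card = c i) :
    Tabloid n c := ⟨g, hg⟩

lemma mem_cellF (μ : Partition n) (x : ℕ × ℕ) :
    x ∈ cellFinset μ ↔ 0 < x.1 ∧ 0 < x.2 ∧ x.2 ≤ μ.parts x.1 := by
  rw [cellFinset, Set.Finite.mem_toFinset]; rfl

open Classical in
/-- The embedding of `M^c` into tensor space. -/
noncomputable def io (c : ℕ → ℕ) : PermMod ℤ n c →ₗ[ℤ] VV n where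
  toFun x g := if hg : ∀ i, (Finset.univ.filter fun k => g k = i).card = c i then x (mkT g hg) else 0
  map_add' x y := by
    funext g
    by_cases hg : ∀ i, (Finset.univ.filter fun k => g k = i).card = c i
    · simp only [Pi.add_apply, dif_pos hg, Finsupp.add_apply]
    · simp only [Pi.add_apply, dif_neg hg, add_zero]
  map_smul' r x := by
    funext g
    by_cases hg : ∀ i, (Finset.univ.filter fun k => g k = i).card = c i
    · simp only [Pi.smul_apply, dif_pos hg, Finsupp.smul_apply, RingHom.id_apply]
    · simp only [Pi.smul_apply, dif_neg hg, smul_zero]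

open Classical in
lemma io_apply (c : ℕ → ℕ) (x : PermMod ℤ n c) (g : Fin n → ℕ) :
    io c x g = if hg : ∀ i, (Finset.univ.filter fun k => g k = i).card = c i
      then x (mkT g hg) else 0 := rfl

lemma io_apply_val (c : ℕ → ℕ) (x : PermMod ℤ n c) (g : Tabloid n c) :
    io c x g.1 = x g := by
  rw [io_apply, dif_pos g.2]; rfl

lemma io_inj {c : ℕ → ℕ} {x : PermMod ℤ n c} (h : io c x = 0) : x = 0 := by
  ext g
  rw [← io_apply_val, h]; rfl

lemma io_single (c : ℕ → ℕ) (f : Tabloid n c) : io c (Finsupp.single f (1 : ℤ)) = dl f.1 := by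
  funext g
  rw [io_apply, dl]
  split_ifs with h1 h2 h2
  · subst h2; exact Finsupp.single_eq_same
  · apply Finsupp.single_eq_of_ne
    rintro rfl; exact h2 rfl
  · exact absurd (h2 ▸ f.2) h1
  · rfl

open Classical in
lemma io_sum_single (c : ℕ → ℕ) (P : (Fin n → ℕ) → Prop)
    (g : Fin n → ℕ) :
    io c (∑ f ∈ Finset.univ.filter (fun f : Tabloid n c => P f.1), Finsupp.single f (1 : ℤ)) g
      = if (∀ i, (Finset.univ.filter fun k => g k = i).card = c i) ∧ P g then 1 else 0 := by
  rw [io_apply]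
  split_ifs with h1 h2 h2
  · rw [Finsupp.finsetSum_apply, Finset.sum_eq_single (mkT g h1)]
    · simp
    · intro f _ hf
      exact Finsupp.single_eq_of_ne hf.symm
    · intro hf
      refine absurd ?_ hf
      rw [Finset.mem_filter]
      exact ⟨Finset.mem_univ _, h2.2⟩
  · rw [Finsupp.finsetSum_apply]
    apply Finset.sum_eq_zero
    intro f hf
    apply Finsupp.single_eq_of_ne
    rintro rfl
    simp only [Finset.mem_filter] at hf
    exact h2 ⟨h1, hf.2⟩
  · exact absurd h2.1 h1
  · rfl

/-- Two linear maps from `M^c` agree after checking on the basis. -/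
lemma perm_ext {c : ℕ → ℕ} {A B : PermMod ℤ n c →ₗ[ℤ] VV n}
    (h : ∀ f : Tabloid n c, A (Finsupp.single f 1) = B (Finsupp.single f 1)) (x : PermMod ℤ n c) :
    A x = B x := by
  have : A = B := by
    apply Finsupp.lhom_ext'
    intro f
    apply LinearMap.ext_ring
    exact h f
  rw [this]

/-- Weight vectors. -/
lemma EE_weight (c : ℕ → ℕ) (x : PermMod ℤ n c) (u : ℕ) :
    EE u u (io c x) = (c u : ℤ) • io c x := by
  funext g
  rw [EE_apply, Pi.smul_apply]
  have h1 : ∀ k, (if g k = u then io c x (Function.update g k u) else 0)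
      = (if g k = u then io c x g else 0) := by
    intro k
    split_ifs with h
    · rw [← h, Function.update_eq_self]
    · rfl
  simp only [h1]
  rw [← Finset.sum_filter, Finset.sum_const, io_apply]
  split_ifs with hg
  · rw [hg u]; simp
  · simp

/-- The relation between `f` and `g` in James' map `ψ`. -/
def Lift (i : ℕ) (f g : Fin n → ℕ) : Prop := ∀ k, g k = f k ∨ (f k = i + 1 ∧ g k = i)

lemma EE_pow_dl (i : ℕ) (f : Fin n → ℕ) (s : ℕ) (g : Fin n → ℕ) :
    open Classical in
    ((EE i (i + 1)) ^ s) (dl f) g = if Lift i f g ∧ (Finset.univ.filter fun k => g k ≠ f k).card = s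
      then (s.factorial : ℤ) else 0 := by
  classical
  induction s generalizing g with
  | zero =>
    have : (Lift i f g ∧ (Finset.univ.filter fun k => g k ≠ f k).card = 0) ↔ g = f := by
      constructor
      · rintro ⟨_, h⟩
        rw [Finset.card_eq_zero, Finset.filter_eq_empty_iff] at h
        funext k
        simpa using h (Finset.mem_univ k)
      · rintro rfl
        exact ⟨fun k => Or.inl rfl, by simp⟩
    rw [if_congr this rfl rfl]
    simp [dl]
  | succ s ih =>
    rw [pow_succ', Module.End.mul_apply, EE_apply]
    simp only [ih]
    -- key equivalence
    have key : ∀ k, (g k = i ∧ Lift i f (Function.update g k (i + 1)) ∧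
        (Finset.univ.filter fun l => Function.update g k (i + 1) l ≠ f l).card = s) ↔
        ((Lift i f g ∧ (Finset.univ.filter fun k => g k ≠ f k).card = s + 1) ∧ g k ≠ f k) := by
      intro k
      have hD : g k = i → f k = i + 1 → (Finset.univ.filter fun l => g l ≠ f l) =
          insert k (Finset.univ.filter fun l => Function.update g k (i + 1) l ≠ f l) := by
        intro h1 h2
        ext l
        by_cases hl : l = k
        · subst hl; simp [h1, h2]
        · simp [hl]
      have hk : f k = i + 1 →
          k ∉ (Finset.univ.filter fun l => Function.update g k (i + 1) l ≠ f l) := by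
        intro h2
        simp [h2]
      constructor
      · rintro ⟨h1, h2, h3⟩
        have h4 : f k = i + 1 := by
          have := h2 k
          simp at this
          omega
        refine ⟨⟨fun l => ?_, ?_⟩, by omega⟩
        · by_cases hl : l = k
          · subst hl; exact Or.inr ⟨h4, h1⟩
          · have := h2 l
            rwa [Function.update_of_ne hl] at this
        · rw [hD h1 h4, Finset.card_insert_of_notMem (hk h4), h3]
      · rintro ⟨⟨h1, h2⟩, h3⟩
        obtain ⟨h4, h5⟩ := (h1 k).resolve_left h3
        refine ⟨h5, fun l => ?_, ?_⟩
        · by_cases hl : l = k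
          · subst hl; simp [h4]
          · rw [Function.update_of_ne hl]; exact h1 l
        · rw [hD h5 h4, Finset.card_insert_of_notMem (hk h4)] at h2
          omega
    have h1 : ∀ k, (if g k = i then (if Lift i f (Function.update g k (i + 1)) ∧
        (Finset.univ.filter fun l => Function.update g k (i + 1) l ≠ f l).card = s
        then (s.factorial : ℤ) else 0) else 0) =
        if ((Lift i f g ∧ (Finset.univ.filter fun k => g k ≠ f k).card = s + 1) ∧ g k ≠ f k)
          then (s.factorial : ℤ) else 0 := by
      intro k
      rw [← ite_and]
      exact if_congr (key k) rfl rfl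
    rw [Finset.sum_congr rfl (fun k _ => h1 k)]
    by_cases h2 : Lift i f g ∧ (Finset.univ.filter fun k => g k ≠ f k).card = s + 1
    · rw [if_pos h2]
      have : ∀ k, ((Lift i f g ∧ (Finset.univ.filter fun k => g k ≠ f k).card = s + 1) ∧ g k ≠ f k)
          ↔ g k ≠ f k := fun k => ⟨fun h => h.2, fun h => ⟨h2, h⟩⟩
      simp only [this]
      rw [← Finset.sum_filter, Finset.sum_const, h2.2, Nat.factorial_succ]
      simp
    · rw [if_neg h2]
      apply Finset.sum_eq_zero
      intro k _
      rw [if_neg (fun h => h2 h.1)]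

lemma lift_type {c : ℕ → ℕ} {i r : ℕ} (hr : r ≤ c (i + 1)) {f g : Fin n → ℕ}
    (hf : ∀ j, (Finset.univ.filter fun k => f k = j).card = c j) (hl : Lift i f g) :
    (∀ j, (Finset.univ.filter fun k => g k = j).card = nuComp c i r j) ↔
      (Finset.univ.filter fun k => g k ≠ f k).card = c (i + 1) - r := by
  classical
  have h1 : (Finset.univ.filter fun k => g k = i + 1).card +
      (Finset.univ.filter fun k => g k ≠ f k).card = c (i + 1) := by
    rw [← hf (i + 1), ← Finset.card_union_of_disjoint]
    · congr 1
      ext k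
      have := hl k
      simp; omega
    · rw [Finset.disjoint_left]
      intro k
      have := hl k
      simp; omega
  have h2 : (Finset.univ.filter fun k => g k = i).card = c i +
      (Finset.univ.filter fun k => g k ≠ f k).card := by
    rw [← hf i, ← Finset.card_union_of_disjoint]
    · congr 1
      ext k
      have := hl k
      simp; omega
    · rw [Finset.disjoint_left]
      intro k
      have := hl k
      simp; omega
  have h3 : ∀ j, j ≠ i → j ≠ i + 1 → (Finset.univ.filter fun k => g k = j).card = c j := by
    intro j hj1 hj2
    rw [← hf j]
    congr 1
    ext k
    have := hl k
    simp; omega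
  constructor
  · intro h
    have := h (i + 1)
    simp [nuComp] at this
    omega
  · intro h j
    unfold nuComp
    split_ifs with hj1 hj2
    · subst hj1; omega
    · subst hj2; omega
    · exact h3 j hj1 hj2

/-- `ψ_{i,r}` is a divided power of a raising operator. -/
lemma psi_pow (c : ℕ → ℕ) (i r : ℕ) (hr : r ≤ c (i + 1)) (x : PermMod ℤ n c) :
    ((EE i (i + 1)) ^ (c (i + 1) - r)) (io c x)
      = ((c (i + 1) - r).factorial : ℤ) • io (nuComp c i r) (psi ℤ c i r x) := by
  classical
  refine perm_ext (A := ((EE i (i + 1)) ^ (c (i + 1) - r)) ∘ₗ io c)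
    (B := ((c (i + 1) - r).factorial : ℤ) • ((io (nuComp c i r)) ∘ₗ (psi ℤ c i r))) ?_ x
  intro f
  funext g
  simp only [LinearMap.comp_apply, LinearMap.smul_apply, Pi.smul_apply]
  rw [io_single, EE_pow_dl]
  have : psi ℤ c i r (Finsupp.single f 1) = ∑ g ∈ Finset.univ.filter
      (fun g : Tabloid n (nuComp c i r) => Lift i f.1 g.1), Finsupp.single g (1 : ℤ) := by
    rw [psi, Finsupp.lift_apply, Finsupp.sum_single_index (by simp), one_smul]
    refine Finset.sum_congr ?_ (fun _ _ => rfl)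
    ext g
    rw [Finset.mem_filter, Finset.mem_filter]
    rfl
  rw [this, io_sum_single]
  by_cases hl : Lift i f.1 g
  · simp only [hl, true_and, and_true, lift_type hr f.2 hl]
    split_ifs <;> simp
  · simp [hl]

/-! ### Polytabloids -/

lemma io_poly {μ : Partition n} (T : Placement μ) (g : Fin n → ℕ) :
    io μ.parts (polytabloid ℤ T) g = ∑ π ∈ colStab T, (Equiv.Perm.sign π : ℤ) *
      (if g = fun k => (T.pos (π k)).1 then 1 else 0) := by
  rw [polytabloid, map_sum, Finset.sum_apply]
  apply Finset.sum_congr rfl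
  intro π _
  rw [map_smul, io_single]
  rfl

lemma EE_poly {μ : Partition n} (T : Placement μ) {u v : ℕ} (hu : 1 ≤ u) (huv : u ≠ v)
    (hle : μ.parts v ≤ μ.parts u) : EE u v (io μ.parts (polytabloid ℤ T)) = 0 := by
  classical
  funext g
  rw [EE_apply]
  simp only [io_poly]
  have h1 : ∀ k, (if g k = u then ∑ π ∈ colStab T, (Equiv.Perm.sign π : ℤ) *
      (if Function.update g k v = fun k => (T.pos (π k)).1 then 1 else 0) else 0)
      = ∑ π ∈ colStab T, (Equiv.Perm.sign π : ℤ) *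
      (if (T.pos (π k)).1 = v ∧ g = fun l => Function.update (fun l => (T.pos l).1) (π k) u (π l)
        then 1 else 0) := by
    intro k
    have key : ∀ π : Equiv.Perm (Fin n), (g k = u ∧ Function.update g k v = fun k => (T.pos (π k)).1)
        ↔ ((T.pos (π k)).1 = v ∧
          g = fun l => Function.update (fun l => (T.pos l).1) (π k) u (π l)) := by
      intro π
      constructor
      · rintro ⟨h1, h2⟩
        refine ⟨by rw [← congrFun h2 k]; simp, ?_⟩
        funext l
        by_cases hl : l = k
        · subst hl; simp [h1]
        · have := congrFun h2 l
          rw [Function.update_of_ne hl] at this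
          rw [Function.update_of_ne (by simpa using hl), this]
      · rintro ⟨h1, h2⟩
        refine ⟨by rw [congrFun h2 k]; simp, ?_⟩
        funext l
        by_cases hl : l = k
        · subst hl; simp [h1]
        · rw [Function.update_of_ne hl, congrFun h2 l, Function.update_of_ne (by simpa using hl)]
    split_ifs with h
    · apply Finset.sum_congr rfl
      intro π _
      have key' := key π
      rw [and_iff_right h] at key'
      rw [if_congr key' rfl rfl]
    · symm
      apply Finset.sum_eq_zero
      intro π _
      rw [if_neg (fun h' => h ((key π).2 h').1), mul_zero]
  rw [Finset.sum_congr rfl (fun k _ => h1 k), Finset.sum_comm]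
  have h2 : ∀ π ∈ colStab T, (∑ k, (Equiv.Perm.sign π : ℤ) *
      (if (T.pos (π k)).1 = v ∧ g = fun l => Function.update (fun l => (T.pos l).1) (π k) u (π l)
        then 1 else 0)) = ∑ x, (Equiv.Perm.sign π : ℤ) *
      (if (T.pos x).1 = v ∧ g = fun l => Function.update (fun l => (T.pos l).1) x u (π l)
        then 1 else 0) := by
    intro π _
    exact Equiv.sum_comp π (fun x => (Equiv.Perm.sign π : ℤ) *
      (if (T.pos x).1 = v ∧ g = fun l => Function.update (fun l => (T.pos l).1) x u (π l)
        then 1 else 0))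
  rw [Finset.sum_congr rfl h2, Finset.sum_comm]
  apply Finset.sum_eq_zero
  intro x _
  by_cases hx : (T.pos x).1 = v
  swap
  · simp [hx]
  obtain ⟨c1, c2, c3⟩ := T.mem x
  obtain ⟨y, hy⟩ := T.surj (u, (T.pos x).2) ⟨hu, c2, by rw [hx] at c3; exact c3.trans hle⟩
  have hxy : x ≠ y := by
    rintro rfl
    rw [hy] at hx
    exact huv hx
  have hcol : ∀ l, (T.pos (Equiv.swap x y l)).2 = (T.pos l).2 := by
    intro l
    rcases Equiv.swap_apply_eq_iff.mp (rfl : Equiv.swap x y l = _) with _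
    by_cases h1 : l = x
    · subst h1; rw [Equiv.swap_apply_left, hy]
    · by_cases h2 : l = y
      · subst h2; rw [Equiv.swap_apply_right, hy]
      · rw [Equiv.swap_apply_of_ne_of_ne h1 h2]
  have hrow : ∀ l, Function.update (fun l => (T.pos l).1) x u (Equiv.swap x y l)
      = Function.update (fun l => (T.pos l).1) x u l := by
    intro l
    by_cases h1 : l = x
    · subst h1; rw [Equiv.swap_apply_left, Function.update_of_ne hxy.symm, hy]; simp
    · by_cases h2 : l = y
      · subst h2; rw [Equiv.swap_apply_right, Function.update_of_ne hxy.symm, hy]; simp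
      · rw [Equiv.swap_apply_of_ne_of_ne h1 h2]
  apply Finset.sum_involution (fun π _ => Equiv.swap x y * π)
  · intro π _
    simp only [Equiv.Perm.sign_mul, Equiv.Perm.sign_swap hxy, Equiv.Perm.mul_apply, hrow]
    push_cast
    ring
  · intro π _ _ h
    have := congrArg (fun σ : Equiv.Perm (Fin n) => σ (π.symm x)) h
    simp at this
    exact hxy this.symm
  · intro π hπ
    simp only [colStab, Finset.mem_filter, Finset.mem_univ, true_and] at hπ ⊢
    intro k
    rw [Equiv.Perm.mul_apply, hcol, hπ]
  · intro π _
    simp [← mul_assoc]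

lemma poly_ne {μ : Partition n} (T : Placement μ) : io μ.parts (polytabloid ℤ T) ≠ 0 := by
  classical
  intro h
  have h1 := congrFun h (fun k => (T.pos k).1)
  rw [io_poly, Finset.sum_eq_single 1] at h1
  · simp at h1
  · intro π hπ hne
    rw [if_neg, mul_zero]
    intro h2
    apply hne
    ext k
    simp only [colStab, Finset.mem_filter, Finset.mem_univ, true_and] at hπ
    have := T.inj (Prod.ext (congrFun h2 k) (hπ k).symm)
    rw [← this]; rfl
  · intro h2
    exact absurd (by simp [colStab]) h2

lemma specht_ker (μ : Partition n) (i r : ℕ) (hi : 1 ≤ i) (hr : r + 1 ≤ μ.parts (i + 1))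
    (x : PermMod ℤ n μ.parts) (hx : x ∈ Specht ℤ μ) : psi ℤ μ.parts i r x = 0 := by
  have : Specht ℤ μ ≤ LinearMap.ker (psi ℤ μ.parts i r) := by
    rw [Specht, Submodule.span_le]
    rintro _ ⟨T, rfl⟩
    simp only [SetLike.mem_coe, LinearMap.mem_ker]
    apply io_inj
    have h1 := psi_pow μ.parts i r (by omega) (polytabloid ℤ T)
    obtain ⟨s, hs⟩ : ∃ s, μ.parts (i + 1) - r = s + 1 := ⟨μ.parts (i + 1) - r - 1, by omega⟩
    rw [hs, pow_succ, Module.End.mul_apply, EE_poly T hi (by omega)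
      (μ.antitone (by omega) (by omega)), map_zero] at h1
    exact (smul_eq_zero.mp h1.symm).resolve_left (by positivity)
  exact this hx

lemma card_row (μ : Partition n) (i : ℕ) :
    ((cellFinset μ).filter fun c => c.1 = i).card = μ.parts i := by
  classical
  by_cases hi : i = 0
  · subst hi
    rw [μ.parts_zero, Finset.card_eq_zero, Finset.filter_eq_empty_iff]
    rintro ⟨x, y⟩ hx
    rw [mem_cellF] at hx
    exact hx.1.ne'
  · have : ((cellFinset μ).filter fun c => c.1 = i) =
        (Finset.Icc 1 (μ.parts i)).image (fun j => (i, j)) := by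
      ext ⟨x, y⟩
      simp only [Finset.mem_filter, mem_cellF, Finset.mem_image, Finset.mem_Icc, Prod.mk.injEq]
      constructor
      · rintro ⟨⟨a1, a2, a3⟩, rfl⟩
        exact ⟨y, ⟨a2, a3⟩, rfl, rfl⟩
      · rintro ⟨z, ⟨a2, a3⟩, rfl, rfl⟩
        exact ⟨⟨by omega, a2, a3⟩, rfl⟩
    rw [this, Finset.card_image_of_injective _ (fun x y h => (Prod.ext_iff.mp h).2), Nat.card_Icc]
    omega

lemma card_cells (μ : Partition n) : (cellFinset μ).card = n := by
  classical
  have h2 : (cellFinset μ).card = ∑ i ∈ μ.finite_support.toFinset,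
      ((cellFinset μ).filter fun c => c.1 = i).card := by
    apply Finset.card_eq_sum_card_fiberwise
    rintro ⟨x, y⟩ hx
    rw [Finset.mem_coe, mem_cellF] at hx
    rw [Finset.mem_coe, Set.Finite.mem_toFinset, Function.mem_support]
    simp only at hx ⊢
    omega
  have h3 := μ.sum_parts
  rw [finsum_eq_sum_of_support_subset _ (s := μ.finite_support.toFinset) (by simp)] at h3
  rw [h2]
  exact (Finset.sum_congr rfl (fun i _ => card_row μ i)).trans h3

lemma exists_placement (μ : Partition n) : Nonempty (Placement μ) := by
  let E := (Finset.equivFinOfCardEq (card_cells μ)).symm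
  refine ⟨⟨fun k => (E k).1, fun k => ?_, fun x y h => E.injective (Subtype.ext h), fun c hc => ?_⟩⟩
  · exact (mem_cellF μ _).mp (E k).2
  · exact ⟨E.symm ⟨c, (mem_cellF μ _).mpr hc⟩, by simp⟩

/-! ### Chains -/

lemma nextIn_mem (X : Finset ℕ) (b u : ℕ) :
    (nextIn X b u ∈ X ∧ u < nextIn X b u) ∨ nextIn X b u = b := by
  have h : nextIn X b u ∈ ({v | v ∈ X ∧ u < v} ∪ {b} : Set ℕ) := Nat.sInf_mem ⟨b, Or.inr rfl⟩
  exact h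

lemma nextIn_le_b (X : Finset ℕ) (b u : ℕ) : nextIn X b u ≤ b := Nat.sInf_le (Or.inr rfl)

lemma nextIn_le {X : Finset ℕ} (b : ℕ) {u v : ℕ} (hv : v ∈ X) (huv : u < v) : nextIn X b u ≤ v :=
  Nat.sInf_le (Or.inl ⟨hv, huv⟩)

lemma nextIn_eq {X : Finset ℕ} {b u w : ℕ} (hb : w ≤ b) (h1 : (w ∈ X ∧ u < w) ∨ w = b)
    (h2 : ∀ v ∈ X, u < v → w ≤ v) : nextIn X b u = w := by
  apply le_antisymm
  · rcases h1 with h1 | h1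
    · exact nextIn_le b h1.1 h1.2
    · rw [h1]; exact nextIn_le_b X b u
  · rcases nextIn_mem X b u with h | h
    · exact h2 _ h.1 h.2
    · omega

lemma nextIn_insert {X : Finset ℕ} {b q u : ℕ} (hq : q ≤ u) :
    nextIn (insert q X) b u = nextIn X b u := by
  apply nextIn_eq (nextIn_le_b _ _ _)
  · rcases nextIn_mem X b u with h | h
    · exact Or.inl ⟨Finset.mem_insert_of_mem h.1, h.2⟩
    · exact Or.inr h
  · intro v hv huv
    rcases Finset.mem_insert.mp hv with h | h
    · omega
    · exact nextIn_le b h huv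

lemma nextIn_gt {X : Finset ℕ} {b u : ℕ} (hu : u < b) : u < nextIn X b u := by
  rcases nextIn_mem X b u with h | h
  · exact h.2
  · omega

lemma telescope (b j : ℕ) (X : Finset ℕ) : (∀ x ∈ X, x < b) → ∀ q, (∀ x ∈ X, q < x) →
    ∑ i ∈ X, ((if j = nextIn X b i then 1 else 0) - (if j = i then 1 else 0) : ℤ)
      = (if j = b then 1 else 0) - (if j = nextIn X b q then 1 else 0) := by
  induction X using Finset.induction_on_min with
  | empty =>
    intro _ q _
    have : nextIn ∅ b q = b := nextIn_eq le_rfl (Or.inr rfl) (by simp)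
    simp [this]
  | insert a s ha ih =>
    intro hb q hq
    have h1 : nextIn (insert a s) b q = a := by
      apply nextIn_eq (hb a (by simp)).le
      · exact Or.inl ⟨by simp, hq a (by simp)⟩
      · intro v hv _
        rcases Finset.mem_insert.mp hv with h | h
        · omega
        · exact (ha v h).le
    rw [Finset.sum_insert (fun h => (ha a h).ne rfl), nextIn_insert le_rfl, h1]
    have h2 : ∑ i ∈ s, ((if j = nextIn (insert a s) b i then 1 else 0)
        - (if j = i then 1 else 0) : ℤ) =
        ∑ i ∈ s, ((if j = nextIn s b i then 1 else 0) - (if j = i then 1 else 0) : ℤ) := by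
      apply Finset.sum_congr rfl
      intro i hi
      rw [nextIn_insert (ha i hi).le]
    rw [h2, ih (fun x hx => hb x (by simp [hx])) a ha]
    ring

/-- `g` is obtained from `f` by moving one symbol along each link of the chain `Q`. -/
def Rel (Q : Finset ℕ) (b : ℕ) (f g : Fin n → ℕ) : Prop :=
  (∀ k, g k ≠ f k → f k ∈ Q ∧ g k = nextIn Q b (f k)) ∧
    ∀ x ∈ Q, ∃ k, (f k = x ∧ g k ≠ f k) ∧ ∀ l, f l = x → g l ≠ f l → l = k

open Classical in
lemma rel_step {Q : Finset ℕ} {b q : ℕ} (hq : ∀ x ∈ Q, q < x) (hqb : q < b)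
    (f : Fin n → ℕ) :
    EE (nextIn Q b q) q (fun g => if Rel Q b f g then 1 else 0)
      = fun g => if Rel (insert q Q) b f g then 1 else 0 := by
  have hqQ : q ∉ Q := fun h => (hq q h).ne rfl
  funext g
  rw [EE_apply]
  have hgt : ∀ x, q < nextIn Q b x := by
    intro x
    rcases nextIn_mem Q b x with h | h
    · exact hq _ h.1
    · omega
  have key1 : ∀ k, g k = nextIn Q b q → Rel Q b f (Function.update g k q) →
      f k = q ∧ Rel (insert q Q) b f g := by
    rintro k hk ⟨h1, h2⟩
    have hfk : f k = q := by
      by_contra hne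
      have := (h1 k (by simpa using Ne.symm hne)).2
      have h3 := hgt (f k)
      simp at this
      omega
    refine ⟨hfk, fun l hl => ?_, fun x hx => ?_⟩
    · by_cases hlk : l = k
      · subst hlk
        rw [hfk, nextIn_insert le_rfl]
        exact ⟨by simp, hk⟩
      · have := h1 l (by rwa [Function.update_of_ne hlk])
        rw [Function.update_of_ne hlk] at this
        rw [nextIn_insert (hq _ this.1).le]
        exact ⟨by simp [this.1], this.2⟩
    · rcases Finset.mem_insert.mp hx with rfl | hx
      · refine ⟨k, ⟨hfk, ?_⟩, fun l hl1 hl2 => ?_⟩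
        · rw [hk, hfk]; exact (hgt _).ne'
        · by_contra hlk
          have := (h1 l (by rwa [Function.update_of_ne hlk])).1
          rw [hl1] at this
          exact hqQ this
      · obtain ⟨m, ⟨hm1, hm2⟩, hm3⟩ := h2 x hx
        have hxq := hq x hx
        have hmk : m ≠ k := by rintro rfl; omega
        rw [Function.update_of_ne hmk] at hm2
        refine ⟨m, ⟨hm1, hm2⟩, fun l hl1 hl2 => hm3 l hl1 ?_⟩
        have hlk : l ≠ k := by rintro rfl; omega
        rwa [Function.update_of_ne hlk]
  by_cases hR : Rel (insert q Q) b f g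
  · rw [if_pos hR]
    obtain ⟨k, ⟨hk1, hk2⟩, hk3⟩ := hR.2 q (by simp)
    have hgk : g k = nextIn Q b q := by
      rw [(hR.1 k hk2).2, hk1, nextIn_insert le_rfl]
    have hRk : Rel Q b f (Function.update g k q) := by
      refine ⟨fun l hl => ?_, fun x hx => ?_⟩
      · have hlk : l ≠ k := by rintro rfl; simp [hk1] at hl
        rw [Function.update_of_ne hlk] at hl ⊢
        have h1 := hR.1 l hl
        have h2 : f l ≠ q := fun h => hlk (hk3 l h hl)
        have h3 : f l ∈ Q := (Finset.mem_insert.mp h1.1).resolve_left h2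
        rw [nextIn_insert (hq _ h3).le] at h1
        exact ⟨h3, h1.2⟩
      · obtain ⟨m, ⟨hm1, hm2⟩, hm3⟩ := hR.2 x (by simp [hx])
        have hxq := hq x hx
        have hmk : m ≠ k := by rintro rfl; omega
        refine ⟨m, ⟨hm1, by rwa [Function.update_of_ne hmk]⟩, fun l hl1 hl2 => hm3 l hl1 ?_⟩
        have hlk : l ≠ k := by rintro rfl; omega
        rwa [Function.update_of_ne hlk] at hl2
    rw [Finset.sum_eq_single k]
    · rw [if_pos hgk, if_pos hRk]
    · intro l _ hlk
      by_cases hl : g l = nextIn Q b q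
      · rw [if_pos hl, if_neg]
        intro hRl
        have hfl := (key1 l hl hRl).1
        refine hlk (hk3 l hfl ?_)
        rw [hl, hfl]; exact (hgt _).ne'
      · rw [if_neg hl]
    · simp
  · rw [if_neg hR]
    apply Finset.sum_eq_zero
    intro k _
    by_cases hk : g k = nextIn Q b q
    · rw [if_pos hk, if_neg (fun h => hR (key1 k hk h).2)]
    · rw [if_neg hk]

/-- The chain operators. -/
noncomputable def ch (X : Finset ℕ) (b : ℕ) : ℕ → ℕ → Module.End ℤ (VV n)
  | 0, q => EE b q
  | d + 1, q => if b - (d + 1) ∈ X then EE (b - (d + 1)) q * ch X b d (b - (d + 1)) else ch X b d q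

lemma ch_congr {X Y : Finset ℕ} {b : ℕ} (d : ℕ) (hd : d ≤ b)
    (h : ∀ x, b - d ≤ x → x < b → (x ∈ X ↔ x ∈ Y)) (q : ℕ) :
    (ch X b d q : Module.End ℤ (VV n)) = ch Y b d q := by
  induction d generalizing q with
  | zero => rfl
  | succ d ih =>
    have ih' := ih (by omega) (fun x hx => h x (by omega))
    have := h (b - (d + 1)) le_rfl (by omega)
    rw [ch, ch, ih', ih', if_congr this rfl rfl]

open Classical in
lemma ch_rel (b : ℕ) (f : Fin n → ℕ) (d : ℕ) (hd : d ≤ b) (q : ℕ) (hq : q < b - d) (Y : Finset ℕ)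
    (hY : ∀ x ∈ Y, b - d ≤ x ∧ x < b) :
    ch Y b d q (dl f) = fun g => if Rel (insert q Y) b f g then 1 else 0 := by
  induction d generalizing q Y with
  | zero =>
    obtain rfl : Y = ∅ := by
      apply Finset.eq_empty_of_forall_notMem
      intro x hx
      have := hY x hx
      omega
    have h1 : nextIn ∅ b q = b := nextIn_eq le_rfl (Or.inr rfl) (by simp)
    have h2 : dl f = fun g => if Rel ∅ b f g then 1 else 0 := by
      funext g
      rw [dl]
      apply if_congr _ rfl rfl
      constructor
      · rintro rfl; exact ⟨by simp, by simp⟩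
      · intro h
        funext k
        by_contra hk
        exact absurd (h.1 k hk).1 (by simp)
    have := rel_step (Q := ∅) (b := b) (q := q) (by simp) (by omega) f
    rw [h1] at this
    rw [ch, h2, this]
  | succ d ih =>
    rw [ch]
    by_cases hu : b - (d + 1) ∈ Y
    · rw [if_pos hu, Module.End.mul_apply]
      rw [ch_congr (Y := Y.erase (b - (d + 1))) d (by omega)
        (fun x hx _ => by simp only [Finset.mem_erase]; constructor
                          · intro h; exact ⟨by omega, h⟩
                          · intro h; exact h.2)]
      rw [ih (by omega) _ (by omega) _ ?_]
      · rw [Finset.insert_erase hu]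
        have h1 : nextIn Y b q = b - (d + 1) := by
          apply nextIn_eq (by omega) (Or.inl ⟨hu, hq⟩)
          intro v hv _
          exact (hY v hv).1
        rw [← rel_step (fun x hx => by have := hY x hx; omega) (by omega) f, h1]
      · intro x hx
        rw [Finset.mem_erase] at hx
        have := hY x hx.2
        omega
    · rw [if_neg hu]
      apply ih (by omega) q (by omega)
      intro x hx
      have := hY x hx
      have h2 : x ≠ b - (d + 1) := by rintro rfl; exact hu hx
      omega

/-- The closure condition of semistandard sets. -/
def Val (R : ℕ → Prop) (q : ℕ) (Y : Finset ℕ) : Prop :=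
  (¬ R q → q + 1 ∈ Y) ∧ ∀ x ∈ Y, ¬ R x → x + 1 ∈ Y

open Classical in
lemma pl_sum (R : ℕ → Prop) (h : ℕ → ℤ) (b : ℕ) (e : VV n) (hRb : ∀ q, q + 1 = b → R q) (d : ℕ) :
    ∀ u, u + d = b → ∀ q, q < u → (R q ∨ q + 1 = u) →
      pl (AS R h) b e u q = ∑ Y ∈ (Finset.Ico u b).powerset,
        (if Val R q Y then (-1) ^ Y.card *
          ∏ x ∈ (Finset.Ico u b).filter R \ Y, h x else 0) • ch Y b d q e := by
  induction d with
  | zero =>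
    intro u hu q hq hR
    obtain rfl : u = b := by omega
    have hRq : R q := by
      rcases hR with h1 | h1
      · exact h1
      · exact hRb q h1
    rw [pl_step _ _ le_rfl, LL_top, pl_top]
    simp [Val, hRq, ch]
  | succ d ih =>
    intro u hu q hq hR
    have hIco : Finset.Ico u b = insert u (Finset.Ico (u + 1) b) := by
      ext x; simp only [Finset.mem_Ico, Finset.mem_insert]; omega
    have hub : b - (d + 1) = u := by omega
    have ih1 := ih (u + 1) (by omega) u (by omega) (Or.inr rfl)
    rw [pl_step _ _ (by omega), LL_lt _ _ (by omega), ih1, hIco,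
      Finset.sum_powerset_insert (by simp), add_comm]
    congr 1
    · -- `u ∉ Y`
      by_cases hRq : R q
      · have hA : AS R h u q = if R u then h u else 1 := by simp [AS, hRq]
        rw [ih (u + 1) (by omega) q (by omega) (Or.inl hRq), hA, Finset.smul_sum]
        apply Finset.sum_congr rfl
        intro Y hY
        rw [Finset.mem_powerset] at hY
        have huY : u ∉ Y := fun h => by have := hY h; simp at this
        rw [ch, hub, if_neg huY, smul_smul]
        congr 1
        by_cases hv : Val R q Y
        · rw [if_pos hv, if_pos hv, Finset.filter_insert]
          by_cases hRu : R u
          · rw [if_pos hRu, if_pos hRu, Finset.insert_sdiff_of_notMem _ huY,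
              Finset.prod_insert (by simp)]
            ring
          · rw [if_neg hRu, if_neg hRu, one_mul]
        · rw [if_neg hv, if_neg hv, mul_zero]
      · obtain rfl : q + 1 = u := by tauto
        have hA : AS R h (q + 1) q = 0 := by simp [AS, hRq]
        rw [hA, zero_smul]
        symm
        apply Finset.sum_eq_zero
        intro Y hY
        rw [Finset.mem_powerset] at hY
        rw [if_neg, zero_smul]
        intro hv
        have := hY (hv.1 hRq)
        simp at this
    · rw [map_neg, map_sum, ← Finset.sum_neg_distrib]
      apply Finset.sum_congr rfl
      intro Y hY
      rw [Finset.mem_powerset] at hY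
      have huY : u ∉ Y := fun h => by have := hY h; simp at this
      rw [map_smul, ch, hub, if_pos (Finset.mem_insert_self u Y), Module.End.mul_apply,
        ch_congr (X := insert u Y) (Y := Y) d (by omega) (fun x hx _ => by
          rw [Finset.mem_insert]
          constructor
          · rintro (h | h)
            · omega
            · exact h
          · exact Or.inr), ← neg_smul]
      congr 1
      have hv : Val R q (insert u Y) ↔ Val R u Y := by
        constructor
        · rintro ⟨h1, h2⟩
          refine ⟨fun hRu => ?_, fun x hx hRx => ?_⟩
          · exact (Finset.mem_insert.mp (h2 u (by simp) hRu)).resolve_left (by omega)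
          · have := hY hx
            simp at this
            exact (Finset.mem_insert.mp (h2 x (by simp [hx]) hRx)).resolve_left (by omega)
        · rintro ⟨h1, h2⟩
          refine ⟨fun hRq => ?_, fun x hx hRx => ?_⟩
          · rw [hR.resolve_left hRq]; simp
          · rcases Finset.mem_insert.mp hx with rfl | hx
            · simp [h1 hRx]
            · simp [h2 x hx hRx]
      have hset : (insert u (Finset.Ico (u + 1) b)).filter R \ insert u Y
          = (Finset.Ico (u + 1) b).filter R \ Y := by
        ext x
        simp only [Finset.mem_sdiff, Finset.mem_filter, Finset.mem_insert, Finset.mem_Ico]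
        constructor
        · rintro ⟨⟨h1, h2⟩, h3⟩
          rw [not_or] at h3
          exact ⟨⟨h1.resolve_left h3.1, h2⟩, h3.2⟩
        · rintro ⟨⟨h1, h2⟩, h3⟩
          exact ⟨⟨Or.inr h1, h2⟩, by rw [not_or]; exact ⟨by omega, h3⟩⟩
      rw [if_congr hv rfl rfl, hset, Finset.card_insert_of_notMem huY]
      split_ifs
      · ring
      · simp

/-! ### Semistandard tableaux -/

section SST

variable {α β : Partition n} {a b : ℕ}

lemma shift_pos (S : OneBoxShift α β a b) {u : ℕ} (hu : 1 ≤ u) (hub : u < b) :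
    α.parts b < α.parts u :=
  lt_of_lt_of_le S.add (α.antitone (by omega) (by omega))

lemma rowC (S : OneBoxShift α β a b) {X : Finset ℕ} (hX : ∀ x ∈ X, a ≤ x ∧ x < b) (i j : ℕ) :
    (rowContent α (tableauOfSet α a b X) i j : ℤ) = (if j = i then (α.parts i : ℤ) else 0) +
      if i ∈ X then ((if j = nextIn X b i then 1 else 0) - (if j = i then 1 else 0)) else 0 := by
  classical
  have hapos := S.a_pos
  have hi0 : ∀ col, col ∈ Finset.Icc 1 (α.parts i) → (i, col) ∈ α.cells := by
    intro col hc
    rw [Finset.mem_Icc] at hc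
    refine ⟨?_, hc.1, hc.2⟩
    rcases Nat.eq_zero_or_pos i with h | h
    · rw [h, α.parts_zero] at hc; omega
    · exact h
  by_cases hi : i ∈ X
  · have hiab := hX i hi
    have hp := shift_pos S (u := i) (by omega) hiab.2
    have hgt : i < nextIn X b i := nextIn_gt hiab.2
    have hT : ∀ col ∈ Finset.Icc 1 (α.parts i), tableauOfSet α a b X (i, col)
        = if col = α.parts i then nextIn X b i else i := by
      intro col hc
      rw [tableauOfSet, if_pos (hi0 col hc)]
      apply if_congr _ _ rfl
      · simp only; omega
      · rw [hatOfSet, if_pos hi]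
    rw [rowContent, Finset.filter_congr (fun col hc => by rw [hT col hc]), if_pos hi]
    by_cases hj : j = i
    · subst hj
      have : (Finset.Icc 1 (α.parts j)).filter
          (fun col => (if col = α.parts j then nextIn X b j else j) = j)
          = Finset.Icc 1 (α.parts j - 1) := by
        ext col
        simp only [Finset.mem_filter, Finset.mem_Icc]
        split_ifs <;> omega
      rw [this, Nat.card_Icc, if_pos rfl, if_neg hgt.ne, if_pos rfl]
      omega
    · rw [if_neg hj, if_neg hj]
      by_cases hj2 : j = nextIn X b i
      · have : (Finset.Icc 1 (α.parts i)).filter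
          (fun col => (if col = α.parts i then nextIn X b i else i) = j) = {α.parts i} := by
          ext col
          simp only [Finset.mem_filter, Finset.mem_Icc, Finset.mem_singleton]
          split_ifs <;> omega
        rw [this, if_pos hj2]; simp
      · have : (Finset.Icc 1 (α.parts i)).filter
          (fun col => (if col = α.parts i then nextIn X b i else i) = j) = ∅ := by
          apply Finset.filter_eq_empty_iff.mpr
          intro col _
          split_ifs <;> omega
        rw [this, if_neg hj2]; simp
  · have hT : ∀ col ∈ Finset.Icc 1 (α.parts i), tableauOfSet α a b X (i, col) = i := by
      intro col hc
      rw [tableauOfSet, if_pos (hi0 col hc)]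
      split_ifs
      · rw [hatOfSet, if_neg hi]
      · rfl
    rw [rowContent, Finset.filter_congr (fun col hc => by rw [hT col hc]), if_neg hi]
    by_cases hj : j = i
    · subst hj
      simp
    · rw [if_neg hj]
      simp [Ne.symm hj]

lemma relJ (S : OneBoxShift α β a b) {X : Finset ℕ} (hX : ∀ x ∈ X, a ≤ x ∧ x < b)
    {f g : Fin n → ℕ} (hf : ∀ i, (Finset.univ.filter fun k => f k = i).card = α.parts i) :
    Rel X b f g ↔ ∀ i j, (Finset.univ.filter fun k => f k = i ∧ g k = j).card
      = rowContent α (tableauOfSet α a b X) i j := by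
  classical
  constructor
  · rintro ⟨h1, h2⟩ i j
    apply Nat.cast_injective (R := ℤ)
    rw [rowC S hX, ← hf i]
    by_cases hi : i ∈ X
    · have hgt : i < nextIn X b i := nextIn_gt (hX i hi).2
      obtain ⟨k, ⟨hk1, hk2⟩, hk3⟩ := h2 i hi
      have hgk := (h1 k hk2).2
      rw [hk1] at hgk
      have hl : ∀ l, f l = i → l ≠ k → g l = i := by
        intro l hl hlk
        by_contra hne
        exact hlk (hk3 l hl (by rwa [hl]))
      rw [if_pos hi]
      by_cases hj : j = i
      · subst hj
        have : Finset.univ.filter (fun l => f l = j ∧ g l = j)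
            = (Finset.univ.filter fun l => f l = j).erase k := by
          ext l
          simp only [Finset.mem_filter, Finset.mem_univ, true_and, Finset.mem_erase]
          constructor
          · rintro ⟨h3, h4⟩
            refine ⟨?_, h3⟩
            rintro rfl
            omega
          · rintro ⟨h3, h4⟩
            exact ⟨h4, hl l h4 h3⟩
        rw [this, Finset.card_erase_of_mem (by simp [hk1]), if_pos rfl, if_neg hgt.ne, if_pos rfl]
        have : 0 < (Finset.univ.filter fun l => f l = j).card :=
          Finset.card_pos.mpr ⟨k, by simp [hk1]⟩
        omega
      · rw [if_neg hj, if_neg hj]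
        by_cases hj2 : j = nextIn X b i
        · have : Finset.univ.filter (fun l => f l = i ∧ g l = j) = {k} := by
            ext l
            simp only [Finset.mem_filter, Finset.mem_univ, true_and, Finset.mem_singleton]
            constructor
            · rintro ⟨h3, h4⟩
              exact hk3 l h3 (by omega)
            · rintro rfl
              exact ⟨hk1, by omega⟩
          rw [this, if_pos hj2]; simp
        · have : Finset.univ.filter (fun l => f l = i ∧ g l = j) = ∅ := by
            apply Finset.filter_eq_empty_iff.mpr
            rintro l - ⟨h3, h4⟩
            by_cases hlk : l = k
            · subst hlk; omega
            · have := hl l h3 hlk; omega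
          rw [this, if_neg hj2]; simp
    · have hl : ∀ l, f l = i → g l = i := by
        intro l hl
        by_contra hne
        exact hi (hl ▸ (h1 l (by rwa [hl])).1)
      rw [if_neg hi]
      by_cases hj : j = i
      · subst hj
        rw [if_pos rfl, add_zero]
        congr 2
        ext l
        simp only [Finset.mem_filter, Finset.mem_univ, true_and]
        exact ⟨fun h => h.1, fun h => ⟨h, hl l h⟩⟩
      · have : Finset.univ.filter (fun l => f l = i ∧ g l = j) = ∅ := by
          apply Finset.filter_eq_empty_iff.mpr
          rintro l - ⟨h3, h4⟩
          have := hl l h3; omega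
        rw [this, if_neg hj]; simp
  · intro hJ
    have h1 : ∀ k, g k ≠ f k → f k ∈ X ∧ g k = nextIn X b (f k) := by
      intro k hk
      have h2 : 0 < (Finset.univ.filter fun l => f l = f k ∧ g l = g k).card :=
        Finset.card_pos.mpr ⟨k, by simp⟩
      rw [hJ] at h2
      have h3 : (0 : ℤ) < rowContent α (tableauOfSet α a b X) (f k) (g k) := by exact_mod_cast h2
      rw [rowC S hX, if_neg hk, if_neg hk] at h3
      by_cases h4 : f k ∈ X
      · refine ⟨h4, ?_⟩
        by_contra h5
        rw [if_neg h5] at h3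
        simp at h3
      · rw [if_neg h4] at h3; simp at h3
    refine ⟨h1, fun x hx => ?_⟩
    have hgt : x < nextIn X b x := nextIn_gt (hX x hx).2
    have h2 : (Finset.univ.filter fun l => f l = x ∧ g l = nextIn X b x).card = 1 := by
      rw [hJ]
      zify
      rw [rowC S hX, if_neg hgt.ne', if_pos hx, if_pos rfl, if_neg hgt.ne']
      simp
    obtain ⟨k, hk⟩ := Finset.card_eq_one.mp h2
    have hk' : ∀ l, (f l = x ∧ g l = nextIn X b x) ↔ l = k := by
      intro l
      have := congrArg (l ∈ ·) hk
      simpa using this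
    have hk1 := (hk' k).2 rfl
    refine ⟨k, ⟨hk1.1, by omega⟩, fun l hl1 hl2 => (hk' l).1 ⟨hl1, ?_⟩⟩
    rw [(h1 l hl2).2, hl1]

lemma sum_rowC (S : OneBoxShift α β a b) {X : Finset ℕ} (hX : ∀ x ∈ X, a ≤ x ∧ x < b)
    (haX : a ∈ X) (j : ℕ) :
    ∑ i ∈ α.finite_support.toFinset, rowContent α (tableauOfSet α a b X) i j = β.parts j := by
  classical
  have hapos := S.a_pos
  have hXs : X ⊆ α.finite_support.toFinset := by
    intro x hx
    have := hX x hx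
    have := shift_pos S (u := x) (by omega) (by omega)
    simp; omega
  zify
  simp only [rowC S hX]
  rw [Finset.sum_add_distrib, Finset.sum_ite_mem, Finset.inter_eq_right.mpr hXs,
    telescope b j X (fun x hx => (hX x hx).2) (a - 1) (fun x hx => by have := hX x hx; omega)]
  have h1 : nextIn X b (a - 1) = a := by
    refine nextIn_eq S.a_lt_b.le (Or.inl ⟨haX, by omega⟩) (fun v hv _ => (hX v hv).1)
  have h2 : ∑ i ∈ α.finite_support.toFinset, (if j = i then (α.parts i : ℤ) else 0)
      = α.parts j := by
    rw [Finset.sum_ite_eq]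
    split_ifs with h
    · rfl
    · simp at h; simp [h]
  rw [h1, h2]
  have hab := S.a_lt_b
  have h3 := S.at_a
  have h4 := S.at_b
  have h5 := S.rem
  by_cases hja : j = a
  · rw [if_neg (by omega), if_pos hja, hja, h3]; omega
  · by_cases hjb : j = b
    · rw [if_pos hjb, if_neg hja, hjb, h4]; push_cast; ring
    · rw [if_neg hjb, if_neg hja, S.elsewhere j hja hjb]; ring

lemma type_of_rel (S : OneBoxShift α β a b) {X : Finset ℕ} (hX : ∀ x ∈ X, a ≤ x ∧ x < b)
    (haX : a ∈ X) {f g : Fin n → ℕ}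
    (hf : ∀ i, (Finset.univ.filter fun k => f k = i).card = α.parts i) (hR : Rel X b f g) (j : ℕ) :
    (Finset.univ.filter fun k => g k = j).card = β.parts j := by
  classical
  rw [← sum_rowC S hX haX j]
  have := (relJ S hX hf).1 hR
  rw [Finset.card_eq_sum_card_fiberwise (f := f) (t := α.finite_support.toFinset)]
  · apply Finset.sum_congr rfl
    intro i _
    rw [← this i j, Finset.filter_filter]
    congr 1
    ext k
    simp [and_comm]
  · intro k _
    have : 0 < (Finset.univ.filter fun l => f l = f k).card := Finset.card_pos.mpr ⟨k, by simp⟩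
    rw [hf] at this
    simp
    omega

lemma type_tab (S : OneBoxShift α β a b) {X : Finset ℕ} (hX : ∀ x ∈ X, a ≤ x ∧ x < b)
    (haX : a ∈ X) : IsTypeOf α β.parts (tableauOfSet α a b X) := by
  classical
  intro j
  rw [← sum_rowC S hX haX j]
  rw [Finset.card_eq_sum_card_fiberwise (f := Prod.fst) (t := α.finite_support.toFinset)]
  · apply Finset.sum_congr rfl
    intro i _
    rw [rowContent, Finset.filter_filter]
    symm
    apply Finset.card_bij (fun c _ => (i, c))
    · intro c hc
      rw [Finset.mem_filter, Finset.mem_Icc] at hc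
      rw [Finset.mem_filter, mem_cellF]
      refine ⟨⟨?_, hc.1.1, hc.1.2⟩, hc.2, rfl⟩
      rcases Nat.eq_zero_or_pos i with h | h
      · rw [h, α.parts_zero] at hc; omega
      · exact h
    · intro c _ d _ h
      exact (Prod.mk.inj h).2
    · rintro ⟨i', c⟩ hc
      rw [Finset.mem_filter, mem_cellF] at hc
      obtain ⟨⟨h1, h2, h3⟩, h4, h5⟩ := hc
      simp only at h5
      subst h5
      exact ⟨c, by rw [Finset.mem_filter, Finset.mem_Icc]; exact ⟨⟨h2, h3⟩, h4⟩, rfl⟩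
  · rintro ⟨i, c⟩ hc
    have hc := (Finset.mem_filter.mp hc).1
    rw [mem_cellF] at hc
    simp at hc ⊢
    omega

lemma ss_tab (S : OneBoxShift α β a b) {X : Finset ℕ} (hX : IsSSSet α a b X) :
    IsSemistandard α (tableauOfSet α a b X) := by
  classical
  have hapos := S.a_pos
  have hab := S.a_lt_b
  obtain ⟨haX, hX1, hX2⟩ := hX
  have hge : ∀ i, i < b → i ≤ hatOfSet X b i := by
    intro i hi
    rw [hatOfSet]
    split_ifs
    · exact (nextIn_gt hi).le
    · rfl
  have hT : ∀ c ∈ α.cells, c.1 ≤ tableauOfSet α a b X c := by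
    intro c hc
    rw [tableauOfSet, if_pos hc]
    split_ifs with h
    · exact hge _ (by omega)
    · rfl
  refine ⟨fun i j j' h1 h2 hj => ?_, fun i i' j h1 h2 hi => ?_⟩
  · by_cases hjl : a ≤ i ∧ i ≤ b - 1 ∧ j = α.parts i
    · have : j = j' := le_antisymm hj (by rw [hjl.2.2]; exact h2.2.2)
      rw [this]
    · have h3 : tableauOfSet α a b X (i, j) = i := by
        rw [tableauOfSet, if_pos h1, if_neg hjl]
      rw [h3]; exact hT _ h2
  · have h3 := hT _ h2
    by_cases hjl : (a ≤ i ∧ i ≤ b - 1 ∧ j = α.parts i) ∧ i ∈ X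
    · have h4 : tableauOfSet α a b X (i, j) = nextIn X b i := by
        rw [tableauOfSet, if_pos h1, if_pos hjl.1, hatOfSet, if_pos hjl.2]
      have h5 : α.parts (i + 1) = α.parts i := by
        apply le_antisymm (α.antitone (i := i) h1.1 (by omega))
        have h6 := α.antitone (i := i + 1) (j := i') (by omega) (by omega)
        have h7 := h2.2.2
        simp only at h7
        omega
      have h6 := hX2 i hjl.2 h5
      have h8 := hX1 _ h6
      have h7 : nextIn X b i = i + 1 :=
        nextIn_eq (by omega) (Or.inl ⟨h6, by omega⟩) (fun v _ hv => hv)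
      rw [h4, h7]
      rcases Nat.lt_or_ge (i + 1) i' with h9 | h9
      · simp only at h3; omega
      · obtain rfl : i' = i + 1 := by omega
        have : tableauOfSet α a b X (i + 1, j) = nextIn X b (i + 1) := by
          rw [tableauOfSet, if_pos h2, if_pos (by simp only; omega), hatOfSet, if_pos h6]
        rw [this]
        exact nextIn_gt (by omega)
    · have h4 : tableauOfSet α a b X (i, j) = i := by
        rw [tableauOfSet, if_pos h1]
        split_ifs with h
        · rw [hatOfSet, if_neg (fun hx => hjl ⟨h, hx⟩)]
        · rfl
      simp only at h3
      omega

lemma tab_mem (S : OneBoxShift α β a b) {X : Finset ℕ} (hX : IsSSSet α a b X) :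
    tableauOfSet α a b X ∈ sstFinset α β := by
  have hab := S.a_lt_b
  rw [sstFinset, Set.Finite.mem_toFinset]
  refine ⟨ss_tab S hX, type_tab S (fun x hx => ?_) hX.1, fun c hc => ?_⟩
  · have := hX.2.1 x hx; omega
  · rw [tableauOfSet, if_neg hc]

lemma Tset_tab (S : OneBoxShift α β a b) {X : Finset ℕ} (hX : IsSSSet α a b X) :
    Tset α a b (tableauOfSet α a b X) = X := by
  classical
  have hapos := S.a_pos
  have hab := S.a_lt_b
  ext u
  rw [Tset, Finset.mem_filter, Finset.mem_Icc]
  have h : a ≤ u ∧ u ≤ b - 1 → hatOf α (tableauOfSet α a b X) u = hatOfSet X b u := by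
    intro hu
    have := shift_pos S (u := u) (by omega) (by omega)
    have hc : (u, α.parts u) ∈ α.cells := ⟨by simp only; omega, by simp only; omega, le_rfl⟩
    rw [hatOf, tableauOfSet, if_pos hc, if_pos ⟨hu.1, hu.2, rfl⟩]
  constructor
  · rintro ⟨h1, h2⟩
    rw [h h1, hatOfSet] at h2
    by_contra h3
    exact h2 (if_neg h3)
  · intro hu
    have h1 := hX.2.1 u hu
    refine ⟨h1, ?_⟩
    rw [h h1, hatOfSet, if_pos hu]
    exact (nextIn_gt (by omega)).ne'

end SST

section Classify

variable {α β : Partition n} {a b : ℕ}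

/-- The cells in rows `≤ m` whose entry exceeds `m`. -/
noncomputable def DD (α : Partition n) (T : ℕ × ℕ → ℕ) (m : ℕ) : Finset (ℕ × ℕ) :=
  (cellFinset α).filter fun c => c.1 ≤ m ∧ m < T c

lemma card_rows (α : Partition n) (m : ℕ) :
    ((cellFinset α).filter fun c => c.1 ≤ m).card = ∑ i ∈ Finset.range (m + 1), α.parts i := by
  classical
  rw [Finset.card_eq_sum_card_fiberwise (f := Prod.fst) (t := Finset.range (m + 1))]
  · apply Finset.sum_congr rfl
    intro i hi
    rw [Finset.mem_range] at hi
    rw [Finset.filter_filter]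
    have : α.parts i = (Finset.Icc 1 (α.parts i)).card := by simp
    rw [this]
    symm
    apply Finset.card_bij (fun c _ => (i, c))
    · intro c hc
      rw [Finset.mem_Icc] at hc
      rw [Finset.mem_filter, mem_cellF]
      refine ⟨⟨?_, hc.1, hc.2⟩, by simp only; omega, rfl⟩
      rcases Nat.eq_zero_or_pos i with h | h
      · rw [h, α.parts_zero] at hc; omega
      · exact h
    · intro c _ d _ h
      exact (Prod.mk.inj h).2
    · rintro ⟨i', c⟩ hc
      rw [Finset.mem_filter, mem_cellF] at hc
      obtain ⟨⟨h1, h2, h3⟩, h4, h5⟩ := hc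
      simp only at h5
      subst h5
      exact ⟨c, by rw [Finset.mem_Icc]; exact ⟨h2, h3⟩, rfl⟩
  · intro c hc
    have := (Finset.mem_filter.mp hc).2
    simp; omega

lemma card_entries {T : ℕ × ℕ → ℕ} (hT : IsTypeOf α β.parts T) (m : ℕ) :
    ((cellFinset α).filter fun c => T c ≤ m).card = ∑ i ∈ Finset.range (m + 1), β.parts i := by
  classical
  rw [Finset.card_eq_sum_card_fiberwise (f := T) (t := Finset.range (m + 1))]
  · apply Finset.sum_congr rfl
    intro i hi
    rw [Finset.mem_range] at hi
    rw [Finset.filter_filter, ← hT i]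
    congr 1
    apply Finset.filter_congr
    intro c _
    omega
  · intro c hc
    have := (Finset.mem_filter.mp hc).2
    simp; omega

lemma sum_shift (S : OneBoxShift α β a b) (m : ℕ) :
    ∑ i ∈ Finset.range (m + 1), α.parts i = ∑ i ∈ Finset.range (m + 1), β.parts i
      + if a ≤ m ∧ m < b then 1 else 0 := by
  have hapos := S.a_pos
  have hab := S.a_lt_b
  have h3 := S.at_a
  have h4 := S.at_b
  have h5 := S.rem
  induction m with
  | zero =>
    have := S.elsewhere 0 (by omega) (by omega)
    simp [this]; omega
  | succ m ih =>
    rw [Finset.sum_range_succ, ih, Finset.sum_range_succ _ (m + 1)]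
    by_cases hja : m + 1 = a
    · rw [hja, h3, if_neg (by omega), if_pos (by omega)]; omega
    · by_cases hjb : m + 1 = b
      · rw [hjb, h4, if_pos (by omega), if_neg (by omega)]; omega
      · rw [S.elsewhere _ hja hjb, add_right_comm]
        congr 1
        apply if_congr (by omega) rfl rfl

lemma entry_ge {T : ℕ × ℕ → ℕ} (hS : IsSemistandard α T) (hT : IsTypeOf α β.parts T) (i : ℕ) :
    ∀ j, (i, j) ∈ α.cells → i ≤ T (i, j) := by
  induction i with
  | zero => intro j h; omega
  | succ i ih =>
    intro j h
    rcases Nat.eq_zero_or_pos i with h0 | h0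
    · subst h0
      have h1 := hT (T (0 + 1, j))
      have h2 : 0 < ((cellFinset α).filter fun cc => T cc = T (0 + 1, j)).card :=
        Finset.card_pos.mpr ⟨(0 + 1, j), by
          rw [Finset.mem_filter, mem_cellF]; exact ⟨h, rfl⟩⟩
      by_contra h3
      have h4 : T (0 + 1, j) = 0 := by omega
      rw [h1, h4, β.parts_zero] at h2
      omega
    · have hc : (i, j) ∈ α.cells := ⟨h0, h.2.1, h.2.2.trans (α.antitone h0 (by simp))⟩
      have := ih j hc
      have := hS.2 i (i + 1) j hc h (by omega)
      omega

lemma card_DD (S : OneBoxShift α β a b) {T : ℕ × ℕ → ℕ} (hS : IsSemistandard α T)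
    (hT : IsTypeOf α β.parts T) (m : ℕ) :
    (DD α T m).card = if a ≤ m ∧ m < b then 1 else 0 := by
  classical
  have h1 := card_rows α m
  have h2 := card_entries hT m
  have h3 := sum_shift S m
  have h4 : DD α T m = ((cellFinset α).filter fun c => c.1 ≤ m) \
      ((cellFinset α).filter fun c => T c ≤ m) := by
    ext c
    simp only [DD, Finset.mem_filter, Finset.mem_sdiff, not_and, not_le]
    tauto
  have h5 : ((cellFinset α).filter fun c => T c ≤ m) ⊆
      ((cellFinset α).filter fun c => c.1 ≤ m) := by
    intro c hc
    rw [Finset.mem_filter] at hc ⊢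
    refine ⟨hc.1, ?_⟩
    have := entry_ge hS hT c.1 c.2 ((mem_cellF α c).1 hc.1)
    exact this.trans hc.2
  rw [h4, Finset.card_sdiff_of_subset h5, h1, h2, h3]
  omega

lemma DD_unique (S : OneBoxShift α β a b) {T : ℕ × ℕ → ℕ} (hS : IsSemistandard α T)
    (hT : IsTypeOf α β.parts T) {m : ℕ} {c d : ℕ × ℕ} (hc : c ∈ α.cells) (hd : d ∈ α.cells)
    (h1 : c.1 ≤ m) (h2 : m < T c) (h3 : d.1 ≤ m) (h4 : m < T d) : c = d ∧ a ≤ m ∧ m < b := by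
  have hc' : c ∈ DD α T m := Finset.mem_filter.mpr ⟨(mem_cellF α c).2 hc, h1, h2⟩
  have hd' : d ∈ DD α T m := Finset.mem_filter.mpr ⟨(mem_cellF α d).2 hd, h3, h4⟩
  have h5 := card_DD S hS hT m
  have h6 : 0 < (DD α T m).card := Finset.card_pos.mpr ⟨c, hc'⟩
  by_cases h : a ≤ m ∧ m < b
  · rw [if_pos h] at h5
    exact ⟨Finset.card_le_one.mp h5.le c hc' d hd', h⟩
  · rw [if_neg h] at h5; omega

lemma DD_exists (S : OneBoxShift α β a b) {T : ℕ × ℕ → ℕ} (hS : IsSemistandard α T)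
    (hT : IsTypeOf α β.parts T) {m : ℕ} (h1 : a ≤ m) (h2 : m < b) :
    ∃ c ∈ α.cells, c.1 ≤ m ∧ m < T c := by
  have h5 := card_DD S hS hT m
  rw [if_pos ⟨h1, h2⟩] at h5
  obtain ⟨c, hc⟩ := Finset.card_pos.mp (by omega : 0 < (DD α T m).card)
  rw [DD, Finset.mem_filter] at hc
  exact ⟨c, (mem_cellF α c).1 hc.1, hc.2⟩

lemma entry_cases (S : OneBoxShift α β a b) {T : ℕ × ℕ → ℕ} (hS : IsSemistandard α T)
    (hT : IsTypeOf α β.parts T) {i j : ℕ} (hc : (i, j) ∈ α.cells) (hne : T (i, j) ≠ i) :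
    i < T (i, j) ∧ a ≤ i ∧ i < b ∧ j = α.parts i := by
  have h1 := entry_ge hS hT i j hc
  have h2 : i < T (i, j) := by omega
  have h3 := (DD_unique S hS hT hc hc le_rfl h2 le_rfl h2).2
  refine ⟨h2, h3.1, h3.2, ?_⟩
  by_contra hj
  have h4 : j ≤ α.parts i := hc.2.2
  have hc' : (i, j + 1) ∈ α.cells := ⟨hc.1, by simp, by simp only; omega⟩
  have h5 := hS.1 i j (j + 1) hc hc' (by omega)
  have h6 := (DD_unique S hS hT hc hc' le_rfl h2 le_rfl (by simp only; omega)).1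
  simp at h6

lemma mem_Tset (S : OneBoxShift α β a b) {T : ℕ × ℕ → ℕ} (hS : IsSemistandard α T)
    (hT : IsTypeOf α β.parts T) {u : ℕ} (hu : u ∈ Tset α a b T) :
    (u, α.parts u) ∈ α.cells ∧ a ≤ u ∧ u < b ∧ u < T (u, α.parts u) := by
  have hapos := S.a_pos
  have hab := S.a_lt_b
  rw [Tset, Finset.mem_filter, Finset.mem_Icc] at hu
  have := shift_pos S (u := u) (by omega) (by omega)
  have hc : (u, α.parts u) ∈ α.cells := ⟨by simp only; omega, by simp only; omega, le_rfl⟩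
  have := entry_cases S hS hT hc hu.2
  exact ⟨hc, by omega, by omega, this.1⟩

lemma Tset_of (S : OneBoxShift α β a b) {T : ℕ × ℕ → ℕ} (hS : IsSemistandard α T)
    (hT : IsTypeOf α β.parts T) {i j : ℕ} (hc : (i, j) ∈ α.cells) (hne : T (i, j) ≠ i) :
    i ∈ Tset α a b T := by
  have := entry_cases S hS hT hc hne
  rw [Tset, Finset.mem_filter, Finset.mem_Icc, hatOf, ← this.2.2.2]
  exact ⟨by omega, hne⟩

lemma Tset_next (S : OneBoxShift α β a b) {T : ℕ × ℕ → ℕ} (hS : IsSemistandard α T)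
    (hT : IsTypeOf α β.parts T) {u : ℕ} (hu : u ∈ Tset α a b T) :
    nextIn (Tset α a b T) b u = T (u, α.parts u) := by
  obtain ⟨hc, h1, h2, h3⟩ := mem_Tset S hS hT hu
  set v := T (u, α.parts u) with hv
  have hvb : v ≤ b := by
    by_contra h
    have := (DD_unique S hS hT (m := b) hc hc h2.le (by omega) h2.le (by omega)).2
    omega
  apply nextIn_eq hvb
  · by_cases hvb' : v = b
    · exact Or.inr hvb'
    · left
      refine ⟨?_, h3⟩
      obtain ⟨⟨i, j⟩, hc', h4, h5⟩ := DD_exists S hS hT (m := v) (by omega) (by omega)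
      simp only at h4
      by_cases hiv : i = v
      · subst hiv
        exact Tset_of S hS hT hc' (by omega)
      · have := (DD_unique S hS hT (m := v - 1) hc hc' (by simp only; omega) (by omega)
          (by simp only; omega) (by omega)).1
        rw [← this] at h5
        omega
  · intro x hx hux
    by_contra hxv
    obtain ⟨hc', h4, h5, h6⟩ := mem_Tset S hS hT hx
    have := (DD_unique S hS hT (m := x) hc hc' hux.le (by omega) le_rfl h6).1
    have := (Prod.mk.inj this).1
    omega

lemma Tset_ss (S : OneBoxShift α β a b) {T : ℕ × ℕ → ℕ} (hS : IsSemistandard α T)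
    (hT : IsTypeOf α β.parts T) : IsSSSet α a b (Tset α a b T) := by
  have hapos := S.a_pos
  have hab := S.a_lt_b
  refine ⟨?_, fun u hu => ?_, fun u hu h => ?_⟩
  · obtain ⟨⟨i, j⟩, hc', h4, h5⟩ := DD_exists S hS hT (m := a) le_rfl hab
    simp only at h4
    have h6 := entry_cases S hS hT hc' (by omega)
    obtain rfl : i = a := by omega
    exact Tset_of S hS hT hc' (by omega)
  · rw [Tset, Finset.mem_filter, Finset.mem_Icc] at hu
    exact hu.1
  · obtain ⟨hc, h1, h2, h3⟩ := mem_Tset S hS hT hu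
    have hc' : (u + 1, α.parts u) ∈ α.cells := ⟨by simp, hc.2.1, h.ge⟩
    have := hS.2 u (u + 1) _ hc hc' (by omega)
    exact Tset_of S hS hT hc' (by omega)

lemma tab_Tset (S : OneBoxShift α β a b) {T : ℕ × ℕ → ℕ} (hT : T ∈ sstFinset α β) :
    tableauOfSet α a b (Tset α a b T) = T := by
  classical
  rw [sstFinset, Set.Finite.mem_toFinset] at hT
  obtain ⟨hS, hT, h0⟩ := hT
  have hapos := S.a_pos
  have hab := S.a_lt_b
  funext ⟨i, j⟩
  rw [tableauOfSet]
  by_cases hc : (i, j) ∈ α.cells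
  · rw [if_pos hc]
    by_cases h : a ≤ i ∧ i ≤ b - 1 ∧ j = α.parts i
    · rw [if_pos h, hatOfSet]
      by_cases hi : i ∈ Tset α a b T
      · rw [if_pos hi, Tset_next S hS hT hi, h.2.2]
      · rw [if_neg hi]
        by_contra hne
        exact hi (Tset_of S hS hT hc (Ne.symm hne))
    · rw [if_neg h]
      by_contra hne
      have := entry_cases S hS hT hc (Ne.symm hne)
      exact h ⟨by omega, by omega, this.2.2.2⟩
  · rw [if_neg hc, h0 _ hc]

open Classical in
lemma sum_sst {M : Type*} [AddCommMonoid M] (S : OneBoxShift α β a b) (F : (ℕ × ℕ → ℕ) → M) :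
    ∑ T ∈ sstFinset α β, F T = ∑ Y ∈ (Finset.Ico (a + 1) b).powerset.filter
      (Val (fun x => α.parts (x + 1) < α.parts x) a), F (tableauOfSet α a b (insert a Y)) := by
  have hapos := S.a_pos
  have hab := S.a_lt_b
  have hrem := S.rem
  have key : ∀ Y ∈ (Finset.Ico (a + 1) b).powerset.filter
      (Val (fun x => α.parts (x + 1) < α.parts x) a), IsSSSet α a b (insert a Y) ∧ a ∉ Y := by
    intro Y hY
    rw [Finset.mem_filter, Finset.mem_powerset] at hY
    obtain ⟨hY, -, hv⟩ := hY
    refine ⟨⟨by simp, fun u hu => ?_, fun u hu h => ?_⟩, fun h => ?_⟩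
    · rcases Finset.mem_insert.mp hu with rfl | hu
      · omega
      · have := hY hu
        rw [Finset.mem_Ico] at this
        omega
    · rcases Finset.mem_insert.mp hu with rfl | hu
      · omega
      · exact Finset.mem_insert_of_mem (hv u hu (by omega))
    · have := hY h
      rw [Finset.mem_Ico] at this
      omega
  refine Finset.sum_bij' (fun T _ => (Tset α a b T).erase a)
    (fun Y _ => tableauOfSet α a b (insert a Y)) ?_ ?_ ?_ ?_ ?_
  · intro T hT
    rw [sstFinset, Set.Finite.mem_toFinset] at hT
    obtain ⟨hS, hT, h0⟩ := hT
    obtain ⟨h1, h2, h3⟩ := Tset_ss S hS hT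
    rw [Finset.mem_filter, Finset.mem_powerset]
    refine ⟨fun x hx => ?_, fun h => absurd hrem h, fun x hx hx2 => ?_⟩
    · rw [Finset.mem_erase] at hx
      have := h2 x hx.2
      rw [Finset.mem_Ico]
      omega
    · rw [Finset.mem_erase] at hx ⊢
      have h4 := h2 x hx.2
      have h5 := α.antitone (i := x) (j := x + 1) (by omega) (by omega)
      exact ⟨by omega, h3 x hx.2 (by omega)⟩
  · intro Y hY
    exact tab_mem S (key Y hY).1
  · intro T hT
    have hT' := hT
    rw [sstFinset, Set.Finite.mem_toFinset] at hT'
    rw [Finset.insert_erase (Tset_ss S hT'.1 hT'.2.1).1, tab_Tset S hT]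
  · intro Y hY
    rw [Tset_tab S (key Y hY).1, Finset.erase_insert (key Y hY).2]
  · intro T hT
    have hT' := hT
    rw [sstFinset, Set.Finite.mem_toFinset] at hT'
    rw [Finset.insert_erase (Tset_ss S hT'.1 hT'.2.1).1, tab_Tset S hT]

lemma io_theta (S : OneBoxShift α β a b) {Y : Finset ℕ} (hY : Y ⊆ Finset.Ico (a + 1) b)
    (x : PermMod ℤ n α.parts) :
    io β.parts (theta ℤ α β.parts (tableauOfSet α a b (insert a Y)) x)
      = ch Y b (b - a - 1) a (io α.parts x) := by
  classical
  have hab := S.a_lt_b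
  have hX : ∀ x ∈ insert a Y, a ≤ x ∧ x < b := by
    intro x hx
    rcases Finset.mem_insert.mp hx with rfl | hx
    · exact ⟨le_rfl, hab⟩
    · have := hY hx
      rw [Finset.mem_Ico] at this
      omega
  refine perm_ext (A := (io β.parts).comp (
    theta ℤ α β.parts (tableauOfSet α a b (insert a Y))))
    (B := (ch Y b (b - a - 1) a).comp (io α.parts)) ?_ x
  intro f
  rw [LinearMap.comp_apply, LinearMap.comp_apply, io_single,
    ch_rel b f.1 (b - a - 1) (by omega) a (by omega) Y (fun x hx => by
      have := hY hx
      rw [Finset.mem_Ico] at this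
      omega)]
  have : theta ℤ α β.parts (tableauOfSet α a b (insert a Y)) (Finsupp.single f 1) =
      ∑ g ∈ Finset.univ.filter (fun g : Tabloid n β.parts => Rel (insert a Y) b f.1 g.1),
        Finsupp.single g (1 : ℤ) := by
    rw [theta, Finsupp.lift_apply, Finsupp.sum_single_index (by simp), one_smul]
    refine Finset.sum_congr ?_ (fun _ _ => rfl)
    ext g
    rw [Finset.mem_filter, Finset.mem_filter, relJ S hX f.2]
  rw [this]
  funext g
  rw [io_sum_single]
  apply if_congr _ rfl rfl
  exact ⟨fun h => h.2, fun h => ⟨type_of_rel S hX (by simp) f.2 h, h⟩⟩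

end Classify

section Final

variable {α β : Partition n} {a b : ℕ}

/-- The Carter-Payne combination on the permutation module. -/
noncomputable def CP (α β : Partition n) (a b : ℕ) :
    PermMod ℤ n α.parts →ₗ[ℤ] PermMod ℤ n β.parts :=
  ∑ T ∈ sstFinset α β, (cpCoeff α a b T) • theta ℤ α β.parts T

lemma io_CP (S : OneBoxShift α β a b) (x : PermMod ℤ n α.parts) :
    io β.parts (CP α β a b x)
      = - pl (AS (fun x => α.parts (x + 1) < α.parts x) (hook α b)) b (io α.parts x) (a + 1) a := by
  classical
  have hapos := S.a_pos
  have hab := S.a_lt_b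
  have hrem := S.rem
  have hadd := S.add
  rw [pl_sum _ _ _ _ (fun q hq => by rw [← hq] at hadd; simpa using hadd) (b - a - 1) (a + 1)
    (by omega) a (by omega) (Or.inl hrem), CP, LinearMap.sum_apply, map_sum, sum_sst S,
    Finset.sum_filter, ← Finset.sum_neg_distrib]
  apply Finset.sum_congr rfl
  intro Y hY
  rw [Finset.mem_powerset] at hY
  by_cases hv : Val (fun x => α.parts (x + 1) < α.parts x) a Y
  · rw [if_pos hv, if_pos hv, LinearMap.smul_apply, map_smul, io_theta S hY, ← neg_smul]
    congr 1
    have haY : a ∉ Y := fun h => by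
      have := hY h
      rw [Finset.mem_Ico] at this
      omega
    have hSS : IsSSSet α a b (insert a Y) := by
      refine ⟨by simp, fun u hu => ?_, fun u hu h => ?_⟩
      · rcases Finset.mem_insert.mp hu with rfl | hu
        · omega
        · have := hY hu
          rw [Finset.mem_Ico] at this
          omega
      · rcases Finset.mem_insert.mp hu with rfl | hu
        · omega
        · exact Finset.mem_insert_of_mem (hv.2 u hu (by omega))
    rw [cpCoeff, Tset_tab S hSS, Finset.card_insert_of_notMem haY, pow_succ, mul_neg_one, neg_mul,
      neg_inj]
    congr 1
    refine Finset.prod_congr ?_ (fun _ _ => rfl)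
    ext x
    simp only [Rset, Finset.mem_sdiff, Finset.mem_filter, Finset.mem_insert, Finset.mem_Ico,
      Finset.mem_Icc, not_or]
    constructor
    · rintro ⟨⟨h1, h2⟩, h3, h4⟩
      exact ⟨⟨by omega, h2⟩, h4⟩
    · rintro ⟨⟨h1, h2⟩, h4⟩
      exact ⟨⟨by omega, h2⟩, by omega, h4⟩
  · rw [if_neg hv, if_neg hv, zero_smul, neg_zero]

lemma hook_pos (S : OneBoxShift α β a b) {u : ℕ} (hu : 1 ≤ u) (hub : u < b) :
    0 < hook α b u := by
  have := shift_pos S hu hub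
  rw [hook, if_pos hub]
  omega

lemma HW_poly (T : Placement α) :
    HW (hook α b) b (io α.parts (polytabloid ℤ T)) (fun i => (α.parts i : ℤ)) where
  hw i hi := EE_poly T hi (by omega) (α.antitone (by omega) (by omega))
  wt i := EE_weight _ _ i
  hb := by simp [hook]
  hstep q hq := by
    rw [hook, hook, if_pos (by omega), if_pos hq]
    push_cast
    ring
  hlast q hq := by
    rw [hook, if_pos (by omega)]
    subst hq
    push_cast
    ring

lemma CP_LL (S : OneBoxShift α β a b) (T : Placement α) :
    ∃ K : ℤ, K ≠ 0 ∧ LL (fun x _ => hook α b x) b (io α.parts (polytabloid ℤ T)) a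
      = K • io β.parts (CP α β a b (polytabloid ℤ T)) := by
  classical
  have hapos := S.a_pos
  have hab := S.a_lt_b
  have hrem := S.rem
  have hadd := S.add
  have h1 := pl_eq_ss (HW_poly (b := b) T) (fun x => α.parts (x + 1) < α.parts x)
    (fun q hq => by rw [← hq] at hadd; simpa using hadd)
    (fun q hq _ hR => by
      have h2 := α.antitone (i := q) (j := q + 1) (by omega) (by omega)
      have h3 : α.parts q = α.parts (q + 1) := by omega
      exact ⟨EE_poly T (by omega) (by omega) h3.le, by simp only [h3]⟩)
    (b - a - 1) (a + 1) (by omega) a hapos (by omega) (Or.inl hrem)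
  rw [if_pos hrem, one_mul] at h1
  rw [LL_lt _ _ hab, h1, io_CP S]
  refine ⟨_, ?_, (smul_neg _ _).symm⟩
  apply Finset.prod_ne_zero_iff.mpr
  intro x hx
  have hx2 := Finset.mem_Ico.mp ((@Finset.mem_filter _ _ (_) _ _).mp hx).1
  exact (hook_pos S (by omega) (by omega)).ne'

lemma VV_torsion {K : ℤ} (hK : K ≠ 0) {x : VV n} (h : K • x = 0) : x = 0 := by
  funext g
  have := congrFun h g
  simp only [Pi.smul_apply, smul_eq_mul, Pi.zero_apply] at this
  exact (mul_eq_zero.mp this).resolve_left hK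

lemma psi_zero {c : ℕ → ℕ} {i r s : ℕ} (hr : r + s ≤ c (i + 1)) {x : PermMod ℤ n c}
    (h : ((EE i (i + 1)) ^ s) (io c x) = 0) : psi ℤ c i r x = 0 := by
  apply io_inj
  have h1 := psi_pow c i r (by omega) x
  obtain ⟨t, ht⟩ := Nat.exists_eq_add_of_le hr
  have h2 : c (i + 1) - r = t + s := by omega
  rw [h2, pow_add, Module.End.mul_apply, h, map_zero] at h1
  exact VV_torsion (by exact_mod_cast (Nat.factorial_pos _).ne') h1.symm

lemma CP_psi (S : OneBoxShift α β a b) {i r : ℕ} (hi : 1 ≤ i) (hr : r + 1 ≤ β.parts (i + 1))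
    (hne : ¬(i = a ∧ r + 1 = β.parts (a + 1))) (T : Placement α) :
    psi ℤ β.parts i r (CP α β a b (polytabloid ℤ T)) = 0 := by
  have hab := S.a_lt_b
  obtain ⟨K, hK, hLL⟩ := CP_LL S T
  have H := HW_poly (b := b) T
  by_cases hia : i = a
  · subst hia
    apply psi_zero (s := 2) (by omega)
    apply VV_torsion hK
    rw [← map_smul, ← hLL, pow_two, Module.End.mul_apply, LL_E_self H hab hi, map_neg, map_smul]
    have : EE i (i + 1) (LL (fun x _ => hook α b x) b (io α.parts (polytabloid ℤ T)) (i + 1))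
        = 0 := by
      rcases Nat.lt_or_ge (i + 1) b with h | h
      · exact LL_E_zero H h hi (by omega)
      · obtain rfl : b = i + 1 := by omega
        rw [LL_top]
        exact H.hw i hi
    rw [this, smul_zero, neg_zero]
  · apply psi_zero (s := 1) (by omega)
    apply VV_torsion hK
    rw [← map_smul, ← hLL, pow_one, LL_E_zero H hab hi hia]

lemma CP_last (S : OneBoxShift α β a b) (T : Placement α) :
    psi ℤ β.parts a (β.parts (a + 1) - 1) (CP α β a b (polytabloid ℤ T)) ≠ 0 := by
  intro h
  have hapos := S.a_pos
  have hab := S.a_lt_b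
  obtain ⟨K, hK, hLL⟩ := CP_LL S T
  have H := HW_poly (b := b) T
  have hb : 1 ≤ β.parts (a + 1) := by
    have := β.antitone (i := a + 1) (j := b) (by omega) (by omega)
    have := S.at_b
    omega
  have h1 := psi_pow β.parts a (β.parts (a + 1) - 1) (by omega) (CP α β a b (polytabloid ℤ T))
  rw [h, map_zero, smul_zero, show β.parts (a + 1) - (β.parts (a + 1) - 1) = 1 by omega,
    pow_one] at h1
  have h2 : EE a (a + 1) (LL (fun x _ => hook α b x) b (io α.parts (polytabloid ℤ T)) a) = 0 := by
    rw [hLL, map_smul, h1, smul_zero]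
  have h3 : ∀ d, a + 1 + d ≤ b →
      LL (fun x _ => hook α b x) b (io α.parts (polytabloid ℤ T)) (a + 1 + d) = 0 := by
    intro d
    induction d with
    | zero =>
      intro _
      rw [LL_E_self H hab hapos, neg_eq_zero] at h2
      exact VV_torsion (hook_pos S hapos hab).ne' h2
    | succ d ih =>
      intro hd
      have h4 := LL_E_self H (u := a + 1 + d) (by omega) (by omega)
      rw [ih (by omega), map_zero] at h4
      exact VV_torsion (hook_pos S (by omega : 1 ≤ a + 1 + d) (by omega)).ne'
        (neg_eq_zero.mp h4.symm)
  have h5 := h3 (b - a - 1) (by omega)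
  rw [show a + 1 + (b - a - 1) = b by omega, LL_top] at h5
  exact poly_ne T h5

lemma sum_thetaHat (x : ↥(Specht ℤ α)) :
    (∑ T ∈ sstFinset α β, (cpCoeff α a b T) • thetaHat ℤ α β.parts T) x = CP α β a b x.1 := by
  rw [CP, LinearMap.sum_apply, LinearMap.sum_apply]
  rfl

end Final

/-- Let `β` be a one-box-shift of `α` (box moved from row `a` to row
`b`), and let `θ̂ := Σ_T ((-1)^{|T|} ∏_{u ∈ {R}∖{T}} h_u) θ̂_T : S^α → M^β` be defined
over `ℤ`, summing over all semistandard `α`-tableaux `T` of type `β`.  Then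
`θ̂ ∘ ψ_{i,r} = 0` for all valid pairs `(i, r)` except possibly
`(i, r) = (a, β_{a+1} - 1)`; consequently, by James's kernel-intersection theorem, the
image of `θ̂` lies in `S_ℤ^β` if and only if `θ̂ ∘ ψ_{a, β_{a+1}-1} = 0`. -/
theorem stmt18 {n : ℕ} (α β : Partition n) (a b : ℕ) (hshift : OneBoxShift α β a b) :
    (∀ i r : ℕ, 1 ≤ i → r + 1 ≤ β.parts (i + 1) → ¬(i = a ∧ r + 1 = β.parts (a + 1)) →
      (psi ℤ β.parts i r).comp
        (∑ T ∈ sstFinset α β, (cpCoeff α a b T) • thetaHat ℤ α β.parts T) = 0) ∧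
    ((∀ x, (∑ T ∈ sstFinset α β, (cpCoeff α a b T) • thetaHat ℤ α β.parts T) x ∈ Specht ℤ β)
      ↔ (psi ℤ β.parts a (β.parts (a + 1) - 1)).comp
          (∑ T ∈ sstFinset α β, (cpCoeff α a b T) • thetaHat ℤ α β.parts T) = 0) := by
  have hab := hshift.a_lt_b
  constructor
  · intro i r hi hr hne
    ext1 x
    rw [LinearMap.comp_apply, sum_thetaHat, LinearMap.zero_apply]
    have : Specht ℤ α ≤ LinearMap.ker ((psi ℤ β.parts i r).comp (CP α β a b)) := by
      rw [Specht, Submodule.span_le]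
      rintro _ ⟨T, rfl⟩
      exact CP_psi hshift hi hr hne T
    exact this x.2
  · have hb : 1 ≤ β.parts (a + 1) := by
      have := β.antitone (i := a + 1) (j := b) (by omega) (by omega)
      have := hshift.at_b
      omega
    constructor
    · intro h
      ext1 x
      rw [LinearMap.comp_apply, LinearMap.zero_apply]
      exact specht_ker β a _ hshift.a_pos (by omega) _ (h x)
    · intro h
      exfalso
      obtain ⟨T⟩ := exists_placement α
      have h1 := LinearMap.congr_fun h
        (⟨polytabloid ℤ T, Submodule.subset_span ⟨T, rfl⟩⟩ : ↥(Specht ℤ α))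
      rw [LinearMap.comp_apply, sum_thetaHat] at h1
      exact CP_last hshift T h1

end CarterPayne
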